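/- arXiv:1408.6243 — 2 statements merged into one kernel-verified Lean document; each statement's English description precedes it below -/
import Mathlib

section
/- Let F be a field and let G be a finitely generated subgroup of the affine group A(F) which is not virtually abelian. Suppose μ is a courteous probability measure on G. Then there exists a positive, non-constant, μ-harmonic function f : G → [0,∞) of linear growth, i.e. with ‖f‖_1 < ∞. Moreover, the vector space spanned by the orbit of f under the G-action (xf)(y) = f(x⁻¹y) is infinite-dimensional: dim span{ xf : x ∈ G } = ∞. -/
/-- The affine group of a field `F`: pairs `(c, λ)` with `λ ∈ Fˣ`, `c ∈ F`,
representing the map `x ↦ λ x + c`. -/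
def Aff (F : Type*) [Field F] : Type _ := F × Fˣ

namespace Aff

variable {F : Type*} [Field F]

/-- Build an element of `Aff F` from a constant term and an invertible scale. -/
def mk (c : F) (l : Fˣ) : Aff F := (c, l)

/-- The translation part `c(x)` of an affine map `x = (c, λ)`. -/
def c (g : Aff F) : F := g.1

/-- The linear part `λ(x)` of an affine map `x = (c, λ)`. -/
def l (g : Aff F) : Fˣ := g.2

instance : Mul (Aff F) := ⟨fun a b => mk (a.c + (a.l : F) * b.c) (a.l * b.l)⟩
instance : One (Aff F) := ⟨mk 0 1⟩
instance : Inv (Aff F) := ⟨fun a => mk (-(((a.l⁻¹ : Fˣ) : F) * a.c)) a.l⁻¹⟩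

@[simp] lemma mul_c (a b : Aff F) : (a * b).c = a.c + (a.l : F) * b.c := rfl
@[simp] lemma mul_l (a b : Aff F) : (a * b).l = a.l * b.l := rfl
@[simp] lemma one_c : (1 : Aff F).c = 0 := rfl
@[simp] lemma one_l : (1 : Aff F).l = 1 := rfl
@[simp] lemma inv_c (a : Aff F) : a⁻¹.c = -(((a.l⁻¹ : Fˣ) : F) * a.c) := rfl
@[simp] lemma inv_l (a : Aff F) : a⁻¹.l = a.l⁻¹ := rfl

lemma ext {a b : Aff F} (hc : a.c = b.c) (hl : a.l = b.l) : a = b :=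
  Prod.ext hc hl

instance : Group (Aff F) where
  mul_assoc a b c := by
    apply ext
    · simp [mul_add, mul_assoc, add_assoc]
    · simp [mul_assoc]
  one_mul a := by apply ext <;> simp
  mul_one a := by apply ext <;> simp
  inv_mul_cancel a := by
    apply ext
    · simp
    · simp

end Aff

open scoped ENNReal

/-- The word length of `x` with respect to a generating set `S`. -/
noncomputable def wordLen {G : Type*} [Group G] (S : Set G) (x : G) : ℕ :=
  sInf {n : ℕ | ∃ l : List G, (∀ s ∈ l, s ∈ S) ∧ l.length = n ∧ l.prod = x}

/-- The polynomial-`k`-seminorm `‖f‖ₖ = limsup_{r → ∞} r^{-k} · max_{|x| ≤ r} |f(x)|`,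
valued in `ℝ≥0∞`, for a real-valued function. -/
noncomputable def polyNormR {G : Type*} [Group G] (S : Set G) (k : ℕ) (f : G → ℝ) : ℝ≥0∞ :=
  Filter.limsup
    (fun r : ℕ => ((r : ℝ≥0∞) ^ k)⁻¹ * ⨆ (x : G) (_ : wordLen S x ≤ r), (‖f x‖₊ : ℝ≥0∞))
    Filter.atTop

/-- Data of one step of the walk, in scale coordinates. -/
theorem max_add_step_abs_sub_le {b y c y' m R : ℝ} (hb : 0 < b) (hy : 0 ≤ y) (hy' : 0 ≤ y')
    (hm : 1 ≤ m) (hc : 0 < c) (hcm : c ≤ m) (hR : 1 ≤ R)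
    (h1 : y' ^ 2 ≤ y ^ 2 + b ^ 2 * m) (h2 : y ^ 2 ≤ y' ^ 2 + b ^ 2 * m) :
    |(max y' (R * (b * c)) + b * c) - (max y (R * b) + b)| ≤ (R + 1) * m * b := by
  have e1 : |y' - y| ≤ R * (b * m) := by
    have hbm : b * m ≤ R * (b * m) := by nlinarith [mul_pos hb (by linarith : 0 < m)]
    have hmm : b ^ 2 * m ≤ (b * m) ^ 2 := by
      nlinarith [mul_nonneg (sq_nonneg b) (mul_nonneg (by linarith : 0 ≤ m) (sub_nonneg.2 hm))]
    have hp : 0 < b * m := by positivity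
    refine le_trans ?_ hbm
    rw [abs_sub_le_iff]
    constructor <;> nlinarith [mul_nonneg hp.le hy, mul_nonneg hp.le hy']
  have e2 : |R * (b * c) - R * b| ≤ R * (b * m) := by
    have : R * (b * c) - R * b = R * (b * (c - 1)) := by ring
    rw [this, abs_mul, abs_mul, abs_of_pos hb, abs_of_pos (by linarith : 0 < R)]
    gcongr
    rw [abs_sub_le_iff]; constructor <;> linarith
  have e3 : |b * c - b| ≤ b * m := by
    have : b * c - b = b * (c - 1) := by ring
    rw [this, abs_mul, abs_of_pos hb]
    gcongr
    rw [abs_sub_le_iff]; constructor <;> linarith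
  have e4 := abs_max_sub_max_le_max y' (R * (b * c)) y (R * b)
  have e5 : |max y' (R * (b * c)) - max y (R * b)| ≤ R * (b * m) := e4.trans (max_le e1 e2)
  rw [abs_le] at *
  constructor <;> nlinarith

theorem exp_le_one_add_add_sq_mul_exp_abs (x : ℝ) :
    Real.exp x ≤ 1 + x + x ^ 2 * Real.exp |x| := by
  have h := Complex.norm_exp_sub_sum_le_norm_mul_exp (x : ℂ) 2
  have h2 : Complex.exp (x : ℂ) - ∑ i ∈ Finset.range 2, (x : ℂ) ^ i / (i.factorial : ℂ)
      = ((Real.exp x - (1 + x) : ℝ) : ℂ) := by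
    simp [Finset.sum_range_succ]
  rw [h2, Complex.norm_real, Complex.norm_real, Real.norm_eq_abs, Real.norm_eq_abs, sq_abs] at h
  linarith [le_abs_self (Real.exp x - (1 + x))]

/-- With `H`, `H'` the sizes before and after a step, the second order bound on
`(H / H') ^ ε`. -/
theorem exp_neg_log_div_le {b H H' m R ε : ℝ} (hb : 0 < b) (hm : 1 ≤ m) (hR : 1 ≤ R)
    (hε : 0 ≤ ε) (hε1 : ε ≤ 1)
    (hH : (R + 1) * b ≤ H) (hH' : (R + 1) * b ≤ m * H')
    (hd : |H' - H| ≤ (R + 1) * m * b) :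
    Real.exp (-(ε * (Real.log H' - Real.log H))) ≤
      1 - ε * (Real.log H' - Real.log H) + ε ^ 2 * (8 * (R + 1) ^ 2 * m ^ 8 * (b / H)) := by
  have hRb : 0 < (R + 1) * b := by positivity
  have hHp : 0 < H := by linarith
  have hm0 : 0 < m := by linarith
  have hHp' : 0 < H' := by
    by_contra h
    have : m * H' ≤ 0 := mul_nonpos_of_nonneg_of_nonpos hm0.le (not_lt.1 h)
    linarith
  have hd' := abs_le.1 hd
  have hbm : (R + 1) * m * b = m * ((R + 1) * b) := by ring
  have hHH' : H' ≤ 2 * m ^ 2 * H := by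
    have : m * ((R + 1) * b) ≤ m * H := by gcongr
    have h3 : H ≤ m ^ 2 * H := le_mul_of_one_le_left hHp.le (one_le_pow₀ hm)
    have h4 : m * H ≤ m ^ 2 * H := by gcongr; nlinarith
    linarith
  have hH'H : H ≤ 2 * m ^ 2 * H' := by
    have : m * ((R + 1) * b) ≤ m * (m * H') := by gcongr
    have h3 : H' ≤ m ^ 2 * H' := le_mul_of_one_le_left hHp'.le (one_le_pow₀ hm)
    nlinarith
  set d := Real.log H' - Real.log H with hdd
  have hdabs : |d| ≤ 2 * m ^ 3 * (R + 1) * (b / H) := by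
    have hK : (R + 1) * m * b / H ≤ 2 * m ^ 3 * (R + 1) * (b / H) := by
      rw [mul_div_assoc, ]
      have : 0 ≤ (R + 1) * (b / H) := by positivity
      have h5 : m ≤ 2 * m ^ 3 := by nlinarith [one_le_pow₀ hm (n := 2)]
      nlinarith
    have hK' : (R + 1) * m * b / H' ≤ 2 * m ^ 3 * (R + 1) * (b / H) := by
      rw [div_le_iff₀ hHp', mul_div_assoc', div_mul_eq_mul_div, le_div_iff₀ hHp]
      have : 0 ≤ (R + 1) * m * b := by positivity
      nlinarith
    rw [abs_le]
    constructor
    · have := Real.log_le_sub_one_of_pos (div_pos hHp hHp')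
      rw [Real.log_div hHp.ne' hHp'.ne'] at this
      have h6 : H / H' - 1 = (H - H') / H' := by field_simp
      have h7 : (H - H') / H' ≤ (R + 1) * m * b / H' := by gcongr; linarith
      linarith
    · have := Real.log_le_sub_one_of_pos (div_pos hHp' hHp)
      rw [Real.log_div hHp'.ne' hHp.ne'] at this
      have h6 : H' / H - 1 = (H' - H) / H := by field_simp
      have h7 : (H' - H) / H ≤ (R + 1) * m * b / H := by gcongr; linarith
      linarith
  have hexp : Real.exp |d| ≤ 2 * m ^ 2 := by
    rw [← Real.le_log_iff_exp_le (by positivity), abs_le]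
    constructor
    · have := Real.log_le_log hHp hH'H
      rw [Real.log_mul (by positivity) hHp'.ne'] at this
      linarith
    · have := Real.log_le_log hHp' hHH'
      rw [Real.log_mul (by positivity) hHp.ne'] at this
      linarith
  have hbH : b / H ≤ 1 := by
    rw [div_le_one hHp]; nlinarith
  have hbH0 : 0 ≤ b / H := by positivity
  have hsq : d ^ 2 * Real.exp |d| ≤ 8 * (R + 1) ^ 2 * m ^ 8 * (b / H) := by
    have : d ^ 2 ≤ (2 * m ^ 3 * (R + 1) * (b / H)) ^ 2 := by
      rw [← sq_abs]; gcongr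
    calc d ^ 2 * Real.exp |d| ≤ (2 * m ^ 3 * (R + 1) * (b / H)) ^ 2 * (2 * m ^ 2) := by gcongr
      _ = 8 * (R + 1) ^ 2 * m ^ 8 * ((b / H) * (b / H)) := by ring
      _ ≤ 8 * (R + 1) ^ 2 * m ^ 8 * ((b / H) * 1) := by gcongr
      _ = _ := by ring
  have h8 := exp_le_one_add_add_sq_mul_exp_abs (-(ε * d))
  have h9 : Real.exp |-(ε * d)| ≤ Real.exp |d| := by
    rw [abs_neg, abs_mul, abs_of_nonneg hε]
    apply Real.exp_le_exp.2
    nlinarith [abs_nonneg d]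
  have h10 : (-(ε * d)) ^ 2 * Real.exp |-(ε * d)| ≤ ε ^ 2 * (d ^ 2 * Real.exp |d|) := by
    have : (-(ε * d)) ^ 2 = ε ^ 2 * d ^ 2 := by ring
    rw [this, mul_assoc]; gcongr
  have h11 : ε ^ 2 * (d ^ 2 * Real.exp |d|) ≤ ε ^ 2 * (8 * (R + 1) ^ 2 * m ^ 8 * (b / H)) := by
    gcongr
  linarith

/-- Lower bound for the change of the logarithmic size away from the axis. -/
theorem log_add_sub_log_add_ge {r r' c m : ℝ} (hr : 1 ≤ r) (hr' : 0 ≤ r') (hm : 1 ≤ m)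
    (hc : 1 ≤ m * c) (h : r ^ 2 ≤ r' ^ 2 + m) :
    Real.log (r + c) - 2 * m ^ 3 / r ^ 2 ≤ Real.log (r' + c) := by
  have hm0 : 0 < m := by linarith
  have hc0 : 0 < c := by
    by_contra h'
    have : m * c ≤ 0 := mul_nonpos_of_nonneg_of_nonpos hm0.le (not_lt.1 h')
    linarith
  have hr0 : 0 < r := by linarith
  have hpos : 0 ≤ 2 * m ^ 3 / r ^ 2 := by positivity
  rcases le_or_gt r r' with hrr | hrr
  · have := Real.log_le_log (by positivity : 0 < r + c) (by linarith : r + c ≤ r' + c)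
    linarith
  have e1 : r * (r - r') ≤ m := by nlinarith
  have e2 : r ≤ 2 * m ^ 2 * (r' + c) := by
    have hc' : m ≤ m ^ 2 * c := by nlinarith
    have hmr : r' ≤ m ^ 2 * r' := le_mul_of_one_le_left hr' (one_le_pow₀ hm)
    rcases le_or_gt (2 * m) (r ^ 2) with h3 | h3
    · nlinarith
    · nlinarith
  have e3 := Real.log_le_sub_one_of_pos (div_pos (by positivity : 0 < r + c)
    (by positivity : 0 < r' + c))
  rw [Real.log_div (by positivity) (by positivity)] at e3
  have e4 : (r + c) / (r' + c) - 1 ≤ 2 * m ^ 3 / r ^ 2 := by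
    rw [div_sub_one (by positivity), div_le_div_iff₀ (by positivity) (by positivity)]
    have : (r + c - (r' + c)) * r ^ 2 = (r * (r - r')) * r := by ring
    rw [this]
    calc r * (r - r') * r ≤ m * (2 * m ^ 2 * (r' + c)) := by gcongr
      _ = _ := by ring
  linarith

theorem log_add_symm_sum_ge {r c τ : ℝ} (hr : 1 ≤ r) (hc : 0 < c) (hτ0 : 0 ≤ τ)
    (hτ : τ ≤ c + c⁻¹ - 2) :
    τ / (4 + τ) / r ≤ (Real.log (r + c) - Real.log (r + 1))
      + (Real.log (r + c⁻¹) - Real.log (r + 1)) := by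
  have hr0 : 0 < r := by linarith
  have hci : 0 < c⁻¹ := by positivity
  have e : (Real.log (r + c) - Real.log (r + 1)) + (Real.log (r + c⁻¹) - Real.log (r + 1))
      = Real.log ((r + c) * (r + c⁻¹) / (r + 1) ^ 2) := by
    rw [Real.log_div (by positivity) (by positivity), Real.log_mul (by positivity) (by positivity),
      Real.log_pow]
    push_cast; ring
  rw [e]
  have e2 : 1 + τ / (4 * r) ≤ (r + c) * (r + c⁻¹) / (r + 1) ^ 2 := by
    rw [le_div_iff₀ (by positivity)]
    have : (r + c) * (r + c⁻¹) = (r + 1) ^ 2 + r * (c + c⁻¹ - 2) := by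
      field_simp; ring
    rw [this]
    have h3 : τ / (4 * r) * (r + 1) ^ 2 ≤ r * τ := by
      rw [div_mul_eq_mul_div, div_le_iff₀ (by positivity)]
      have : (r + 1) ^ 2 ≤ 4 * r ^ 2 := by nlinarith
      nlinarith
    nlinarith
  have e3 := Real.log_le_log (by positivity) e2
  have e4 := Real.one_sub_inv_le_log_of_pos (by positivity : 0 < 1 + τ / (4 * r))
  have e5 : τ / (4 + τ) / r ≤ 1 - (1 + τ / (4 * r))⁻¹ := by
    have : 1 - (1 + τ / (4 * r))⁻¹ = τ / (4 * r + τ) := by field_simp; ring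
    rw [this, div_div]
    gcongr
    nlinarith
  linarith

theorem logistic_rpow_le {H H' : ℝ} (hH : 0 < H) (hH' : 0 < H') (ε : ℝ) :
    1 / (1 + H' ^ ε) ≤ 1 / (1 + H ^ ε)
      + H ^ ε / (1 + H ^ ε) ^ 2 * (Real.exp (-(ε * (Real.log H' - Real.log H))) - 1) := by
  have e : Real.exp (-(ε * (Real.log H' - Real.log H))) = H ^ ε / H' ^ ε := by
    rw [Real.rpow_def_of_pos hH, Real.rpow_def_of_pos hH', ← Real.exp_sub]
    congr 1; ring
  rw [e]
  have ha : 0 < H ^ ε := Real.rpow_pos_of_pos hH ε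
  have hc : 0 < H' ^ ε := Real.rpow_pos_of_pos hH' ε
  generalize H ^ ε = a at *
  generalize H' ^ ε = c at *
  rw [← sub_nonneg]
  have : 1 / (1 + a) + a / (1 + a) ^ 2 * (a / c - 1) - 1 / (1 + c)
      = (a - c) ^ 2 / ((1 + a) ^ 2 * c * (1 + c)) := by
    field_simp; ring
  rw [this]; positivity

theorem logistic_rpow_derivative_ge {H ε : ℝ} (hH : 0 < H) (hε : 0 ≤ ε) (hε1 : ε ≤ 1) :
    1 / (4 * (1 + H) ^ 2) ≤ H ^ ε / (1 + H ^ ε) ^ 2 / H := by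
  have ha : 0 < H ^ ε := Real.rpow_pos_of_pos hH ε
  rw [div_div, div_le_div_iff₀ (by positivity) (by positivity)]
  rcases le_or_gt H 1 with h | h
  · have h1 : H ^ ε ≤ 1 := Real.rpow_le_one hH.le h hε
    have h2 : H ≤ H ^ ε := by
      simpa using Real.rpow_le_rpow_of_exponent_ge hH h hε1
    have h3 : (1 + H ^ ε) ^ 2 ≤ 4 := by nlinarith
    have h4 : 1 ≤ (1 + H) ^ 2 := by nlinarith
    calc 1 * ((1 + H ^ ε) ^ 2 * H) ≤ 4 * H ^ ε := by rw [one_mul]; gcongr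
      _ ≤ H ^ ε * (4 * (1 + H) ^ 2) := by nlinarith
  · have h1 : 1 ≤ H ^ ε := Real.one_le_rpow h.le hε
    have h2 : H ^ ε ≤ H := by
      simpa using Real.rpow_le_rpow_of_exponent_le h.le hε1
    have h3 : (1 + H ^ ε) ^ 2 ≤ 4 * (H ^ ε) ^ 2 := by nlinarith
    have h4 : H * H ≤ (1 + H) ^ 2 := by nlinarith
    calc 1 * ((1 + H ^ ε) ^ 2 * H) ≤ 4 * (H ^ ε) ^ 2 * H := by rw [one_mul]; gcongr
      _ = 4 * H ^ ε * (H ^ ε * H) := by ring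
      _ ≤ 4 * H ^ ε * (H * H) := by gcongr
      _ ≤ H ^ ε * (4 * (1 + H) ^ 2) := by nlinarith

/-- The approximately harmonic profile: at scale `b` and distance `y ^ 2` from the base point. -/
noncomputable def cuspProfile (b y : ℝ) : ℝ := max 0 (-Real.log b) * max 0 (1 - y ^ 2)

theorem cuspProfile_nonneg (b y : ℝ) : 0 ≤ cuspProfile b y :=
  mul_nonneg (le_max_left _ _) (le_max_left _ _)

theorem cuspProfile_le_abs_log (b y : ℝ) : cuspProfile b y ≤ |Real.log b| := by
  have h1 : max 0 (-Real.log b) ≤ |Real.log b| := max_le (abs_nonneg _) (neg_le_abs _)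
  have h2 : max 0 (1 - y ^ 2) ≤ 1 := max_le zero_le_one (by nlinarith)
  calc cuspProfile b y ≤ |Real.log b| * 1 := by
        unfold cuspProfile
        exact mul_le_mul h1 h2 (le_max_left _ _) (abs_nonneg _)
    _ = _ := mul_one _

set_option maxHeartbeats 800000 in
/-- The first order change of `cuspProfile` along a step. -/
theorem abs_cuspProfile_step_le {b y c y' m R : ℝ} (hb : 0 < b) (hy : 0 ≤ y)
    (hm : 1 ≤ m) (hc : 0 < c) (hcm : c ≤ m) (hc' : 1 ≤ m * c) (hR : 1 ≤ R)
    (h1 : y' ^ 2 ≤ y ^ 2 + b ^ 2 * m) (h2 : y ^ 2 ≤ y' ^ 2 + b ^ 2 * m) :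
    |cuspProfile (b * c) y' - cuspProfile b y
        + (if b ≤ 1 then max 0 (1 - y ^ 2) else 0) * Real.log c|
      ≤ 3 * (R + 4) ^ 2 * m ^ 6 * (b / (1 + (max y (R * b) + b)) ^ 2) := by
  have hm0 : 0 < m := by linarith
  have hHle : max y (R * b) ≤ y + R * b := max_le (by nlinarith) (by nlinarith)
  have hHp : 0 < max y (R * b) := lt_max_of_lt_right (by positivity)
  set H := max y (R * b) + b with hH
  have hrhs : 0 ≤ 3 * (R + 4) ^ 2 * m ^ 6 * (b / (1 + H) ^ 2) := by positivity
  set φ := max 0 (1 - y ^ 2) with hφ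
  set φ' := max 0 (1 - y' ^ 2) with hφ'
  have hφ0 : 0 ≤ φ := le_max_left _ _
  have hφ0' : 0 ≤ φ' := le_max_left _ _
  have hφ1 : φ ≤ 1 := max_le zero_le_one (by nlinarith)
  have hφ1' : φ' ≤ 1 := max_le zero_le_one (by nlinarith)
  have hlm : Real.log m ≤ m := by linarith [Real.log_le_sub_one_of_pos hm0]
  have hlm0 : 0 ≤ Real.log m := Real.log_nonneg hm
  have hlc : Real.log c ≤ Real.log m := Real.log_le_log hc hcm
  have hlc' : -Real.log m ≤ Real.log c := by
    have := Real.log_le_log one_pos hc'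
    rw [Real.log_mul hm0.ne' hc.ne', Real.log_one] at this
    linarith
  have hlog : Real.log (b * c) = Real.log b + Real.log c := Real.log_mul hb.ne' hc.ne'
  unfold cuspProfile
  rw [← hφ, ← hφ', hlog]
  rcases le_or_gt b 1 with hb1 | hb1
  · rw [if_pos hb1]
    have hlb : Real.log b ≤ 0 := Real.log_nonpos hb.le hb1
    have hblb : b * -Real.log b ≤ 1 := by
      have := Real.one_sub_inv_le_log_of_pos hb
      have : b * -Real.log b ≤ b * (b⁻¹ - 1) := by gcongr; linarith
      have h3 : b * (b⁻¹ - 1) = 1 - b := by field_simp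
      linarith
    rw [max_eq_right (by linarith : 0 ≤ -Real.log b)]
    by_cases hzero : φ = 0 ∧ φ' = 0
    · rw [hzero.1, hzero.2]; simpa using hrhs
    have hy2 : y ^ 2 ≤ 2 * m := by
      have hb2m : b ^ 2 * m ≤ m := mul_le_of_le_one_left hm0.le (pow_le_one₀ hb.le hb1)
      by_contra hcon
      rw [not_le] at hcon
      refine hzero ⟨max_eq_left (by nlinarith), max_eq_left (by nlinarith)⟩
    have hyle : y ≤ 2 * m := by nlinarith
    have hH1 : 1 + H ≤ (R + 4) * m := by
      have : R * b ≤ R * 1 := by gcongr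
      nlinarith
    set L := Real.log b + Real.log c with hL
    have hT : max 0 (-L) * φ' - -Real.log b * φ + φ * Real.log c
        = max 0 (-L) * (φ' - φ) + max 0 L * φ := by
      have : max 0 (-L) = max 0 L - L := by
        rcases le_total 0 L with h | h
        · rw [max_eq_left (by linarith), max_eq_right h]; ring
        · rw [max_eq_right (by linarith), max_eq_left h]; ring
      rw [this, hL]; ring
    rw [hT]
    have hdφ : |φ' - φ| ≤ b ^ 2 * m := by
      have := abs_max_sub_max_le_max 0 (1 - y' ^ 2) 0 (1 - y ^ 2)
      refine this.trans (max_le (by simp; positivity) ?_)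
      rw [abs_sub_le_iff]; constructor <;> linarith
    have hLneg : max 0 (-L) ≤ -Real.log b + m := max_le (by linarith) (by linarith)
    have hLpos : max 0 L ≤ b * m := by
      refine max_le (by positivity) ?_
      have h3 : Real.log (b * c) ≤ b * c - 1 := Real.log_le_sub_one_of_pos (by positivity)
      have : b * c ≤ b * m := by gcongr
      linarith [hlog]
    have hbound : |max 0 (-L) * (φ' - φ) + max 0 L * φ| ≤ 3 * m ^ 2 * b := by
      calc |max 0 (-L) * (φ' - φ) + max 0 L * φ|
          ≤ |max 0 (-L) * (φ' - φ)| + |max 0 L * φ| := abs_add_le _ _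
        _ = max 0 (-L) * |φ' - φ| + max 0 L * φ := by
            rw [abs_mul, abs_mul, abs_of_nonneg (le_max_left 0 (-L)),
              abs_of_nonneg (le_max_left 0 L), abs_of_nonneg hφ0]
        _ ≤ (-Real.log b + m) * (b ^ 2 * m) + b * m * 1 := by
            gcongr
            linarith
        _ = (b * -Real.log b) * (b * m) + b * b * m ^ 2 + b * m := by ring
        _ ≤ 1 * (b * m) + b * 1 * m ^ 2 + b * m := by gcongr
        _ ≤ 3 * m ^ 2 * b := by
            have : b * m ≤ b * m ^ 2 := by gcongr; nlinarith
            linarith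
    refine hbound.trans ?_
    have hsq : (1 + H) ^ 2 ≤ ((R + 4) * m) ^ 2 := by gcongr
    rw [mul_div_assoc', le_div_iff₀ (by positivity)]
    calc 3 * m ^ 2 * b * (1 + H) ^ 2 ≤ 3 * m ^ 2 * b * ((R + 4) * m) ^ 2 := by gcongr
      _ = 3 * (R + 4) ^ 2 * m ^ 4 * b := by ring
      _ ≤ 3 * (R + 4) ^ 2 * m ^ 6 * b := by (gcongr; norm_num [hm])
  · rw [if_neg (not_le.2 hb1), max_eq_left (by linarith [Real.log_pos hb1] : -Real.log b ≤ 0)]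
    rw [zero_mul, zero_mul, sub_zero, add_zero, abs_of_nonneg (mul_nonneg (le_max_left _ _) hφ0')]
    by_cases hzero : φ' = 0
    · rw [hzero, mul_zero]; exact hrhs
    by_cases hzero' : 0 ≤ Real.log b + Real.log c
    · rw [max_eq_left (by linarith), zero_mul]; exact hrhs
    rw [not_le] at hzero'
    have hy2 : y' ^ 2 ≤ 1 := by
      by_contra hcon
      rw [not_le] at hcon
      exact hzero (max_eq_left (by linarith))
    have hbc : b * c < 1 := by
      rw [← Real.log_neg_iff (by positivity)]; linarith
    have hbm : b ≤ m := le_of_mul_le_mul_right (by linarith : b * c ≤ m * c) hc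
    have hm2 : 1 ≤ m ^ 2 := one_le_pow₀ hm
    have hm23 : m ^ 2 ≤ m ^ 3 := pow_le_pow_right₀ hm (by norm_num)
    have hm12 : m ≤ m ^ 2 := by nlinarith
    have hyle : y ≤ 2 * m ^ 2 := by
      have : y ^ 2 ≤ 1 + m ^ 2 * m := by
        have : b ^ 2 * m ≤ m ^ 2 * m := by gcongr
        linarith
      have h34 : m ^ 3 ≤ m ^ 4 := pow_le_pow_right₀ hm (by norm_num)
      refine (pow_le_pow_iff_left₀ hy (by positivity) two_ne_zero).1 ?_
      have h4 : (2 * m ^ 2) ^ 2 = 4 * m ^ 4 := by ring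
      have h3 : m ^ 2 * m = m ^ 3 := by ring
      linarith
    have hH1 : 1 + H ≤ (R + 4) * m ^ 2 := by
      have : R * b ≤ R * m ^ 2 := by gcongr; linarith
      linarith
    have hT : max 0 (-(Real.log b + Real.log c)) * φ' ≤ m * 1 := by
      have := Real.log_pos hb1
      gcongr
      exact max_le hm0.le (by linarith)
    refine hT.trans ?_
    rw [mul_one, mul_div_assoc', le_div_iff₀ (by positivity)]
    calc m * (1 + H) ^ 2 ≤ m * ((R + 4) * m ^ 2) ^ 2 := by gcongr
      _ = 1 * (R + 4) ^ 2 * m ^ 5 * 1 := by ring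
      _ ≤ 3 * (R + 4) ^ 2 * m ^ 6 * b := by gcongr <;> norm_num [hm]

/-- Between a subharmonic and a nonnegative superharmonic function there is a nonnegative
harmonic function. -/
theorem exists_harmonic_between {G : Type*} [Group G] (ν : G → ℝ) (hν : ∀ s, 0 ≤ ν s)
    (lo hi : G → ℝ) (hle : ∀ x, lo x ≤ hi x) (hhi : ∀ x, 0 ≤ hi x)
    (hsum : ∀ x, Summable fun s => ν s * hi (x * s))
    (hsumlo : ∀ x, Summable fun s => ν s * lo (x * s))
    (hsuper : ∀ x, ∑' s, ν s * hi (x * s) ≤ hi x)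
    (hsub : ∀ x, lo x ≤ ∑' s, ν s * lo (x * s)) :
    ∃ f : G → ℝ, (∀ x, 0 ≤ f x) ∧ (∀ x, lo x ≤ f x) ∧ (∀ x, f x ≤ hi x) ∧
      (∀ x, Summable fun s => ν s * f (x * s)) ∧ ∀ x, f x = ∑' s, ν s * f (x * s) := by
  have key : ∀ g : G → ℝ, (∀ x, 0 ≤ g x) → (∀ x, g x ≤ hi x) →
      ∀ x, Summable fun s => ν s * g (x * s) := fun g h0 h1 x =>
    Summable.of_nonneg_of_le (fun s => mul_nonneg (hν s) (h0 _))
      (fun s => mul_le_mul_of_nonneg_left (h1 _) (hν s)) (hsum x)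
  have mono : ∀ g g' : G → ℝ, (∀ x, g x ≤ g' x) → (∀ x, Summable fun s => ν s * g (x * s)) →
      (∀ x, Summable fun s => ν s * g' (x * s)) →
      ∀ x, ∑' s, ν s * g (x * s) ≤ ∑' s, ν s * g' (x * s) := fun g g' h h1 h2 x =>
    (h1 x).tsum_le_tsum (fun s => mul_le_mul_of_nonneg_left (h _) (hν s)) (h2 x)
  let A : Set (G → ℝ) := {g | (∀ x, 0 ≤ g x) ∧ (∀ x, g x ≤ hi x) ∧
    ∀ x, g x ≤ ∑' s, ν s * g (x * s)}
  have hzero : (fun _ => 0 : G → ℝ) ∈ A := ⟨fun _ => le_rfl, hhi, by simp⟩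
  have : Nonempty A := ⟨⟨_, hzero⟩⟩
  have hbdd : ∀ x, BddAbove (Set.range fun g : A => g.1 x) := fun x =>
    ⟨hi x, by rintro _ ⟨g, rfl⟩; exact g.2.2.1 x⟩
  obtain ⟨f, hf⟩ : ∃ f : G → ℝ, ∀ x, f x = ⨆ g : A, g.1 x := ⟨_, fun _ => rfl⟩
  have hfge : ∀ g ∈ A, ∀ x, g x ≤ f x := fun g hg x => by
    rw [hf]; exact le_ciSup (hbdd x) ⟨g, hg⟩
  have hfle : ∀ x (c : ℝ), (∀ g ∈ A, g x ≤ c) → f x ≤ c := fun x c h => by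
    rw [hf]; exact ciSup_le fun g => h g.1 g.2
  have hf0 : ∀ x, 0 ≤ f x := hfge _ hzero
  have hfhi : ∀ x, f x ≤ hi x := fun x => hfle x _ fun g hg => hg.2.1 x
  have hfs := key f hf0 hfhi
  have hfsub : ∀ x, f x ≤ ∑' s, ν s * f (x * s) := fun x => hfle x _ fun g hg =>
    (hg.2.2 x).trans (mono g f (hfge g hg) (key g hg.1 hg.2.1) hfs x)
  obtain ⟨F, hF⟩ : ∃ F : G → ℝ, ∀ x, F x = ∑' s, ν s * f (x * s) := ⟨_, fun _ => rfl⟩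
  have hFA : F ∈ A := by
    have h0 : ∀ x, 0 ≤ F x := fun x => by rw [hF]; exact (hf0 x).trans (hfsub x)
    have h1 : ∀ x, F x ≤ hi x := fun x => by
      rw [hF]; exact (mono f hi hfhi hfs hsum x).trans (hsuper x)
    refine ⟨h0, h1, fun x => ?_⟩
    rw [hF]
    exact mono f F (fun x => by rw [hF]; exact hfsub x) hfs (key F h0 h1) x
  obtain ⟨g, hg⟩ : ∃ g : G → ℝ, ∀ x, g x = max 0 (lo x) := ⟨_, fun _ => rfl⟩
  have hlog : ∀ x, lo x ≤ g x := fun x => by rw [hg]; exact le_max_right _ _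
  have hgA : g ∈ A := by
    have h0 : ∀ x, 0 ≤ g x := fun x => by rw [hg]; exact le_max_left _ _
    have h1 : ∀ x, g x ≤ hi x := fun x => by rw [hg]; exact max_le (hhi x) (hle x)
    refine ⟨h0, h1, fun x => ?_⟩
    rw [hg]
    refine max_le (tsum_nonneg fun s => mul_nonneg (hν s) (h0 _)) ?_
    exact (hsub x).trans (mono lo g hlog hsumlo (key g h0 h1) x)
  exact ⟨f, hf0, fun x => (hlog x).trans (hfge g hgA x), hfhi, hfs,
    fun x => le_antisymm (hfsub x) (by rw [← hF]; exact hfge F hFA x)⟩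

theorem abs_log_sub_log_le {b H H' m R : ℝ} (hb : 0 < b) (hm : 1 ≤ m) (hR : 1 ≤ R)
    (hH : (R + 1) * b ≤ H) (hH' : (R + 1) * b ≤ m * H')
    (hd : |H' - H| ≤ (R + 1) * m * b) : |Real.log H' - Real.log H| ≤ m ^ 2 := by
  have hRb : 0 < (R + 1) * b := by positivity
  have hHp : 0 < H := by linarith
  have hm0 : 0 < m := by linarith
  have hHp' : 0 < H' := by
    by_contra h
    have : m * H' ≤ 0 := mul_nonpos_of_nonneg_of_nonpos hm0.le (not_lt.1 h)
    linarith
  have hd' := abs_le.1 hd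
  have hbm : (R + 1) * m * b = m * ((R + 1) * b) := by ring
  rw [abs_le]
  constructor
  · have := Real.log_le_sub_one_of_pos (div_pos hHp hHp')
    rw [Real.log_div hHp.ne' hHp'.ne'] at this
    have h2 : H / H' ≤ m ^ 2 + 1 := by
      rw [div_le_iff₀ hHp']
      have : m * ((R + 1) * b) ≤ m * (m * H') := by gcongr
      nlinarith
    linarith
  · have := Real.log_le_sub_one_of_pos (div_pos hHp' hHp)
    rw [Real.log_div hHp'.ne' hHp.ne'] at this
    have h2 : H' / H ≤ m ^ 2 + 1 := by
      rw [div_le_iff₀ hHp]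
      have : m * ((R + 1) * b) ≤ m * H := by gcongr
      have h4 : m * H ≤ m ^ 2 * H := by gcongr; nlinarith
      nlinarith
    linarith

/-- A fully supported symmetric random walk together with an action by similarities on a
pseudometric space: `B x ^ 2` is the ratio of the similarity `x`, and `Y x ^ 2` is the distance
by which `x` moves the base point. The function `m` controls the size of the steps. -/
structure SimilarityWalk (G : Type*) [Group G] where
  ν : G → ℝ
  B : G → ℝ
  Y : G → ℝ
  m : G → ℝ
  ν_pos : ∀ s, 0 < ν s
  ν_hasSum : HasSum ν 1
  ν_inv : ∀ s, ν s⁻¹ = ν s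
  B_pos : ∀ x, 0 < B x
  B_mul : ∀ x y, B (x * y) = B x * B y
  Y_nonneg : ∀ x, 0 ≤ Y x
  Y_mul : ∀ x y, Y (x * y) ^ 2 ≤ Y x ^ 2 + B x ^ 2 * Y y ^ 2
  Y_inv : ∀ x, B x ^ 2 * Y x⁻¹ ^ 2 = Y x ^ 2
  one_le_m : ∀ s, 1 ≤ m s
  B_le : ∀ s, B s ≤ m s
  one_le_mul_B : ∀ s, 1 ≤ m s * B s
  Y_le : ∀ s, Y s ^ 2 ≤ m s
  moment : Summable fun s => ν s * m s ^ 8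

namespace SimilarityWalk

variable {G : Type*} [Group G] (W : SimilarityWalk G)

theorem B_one : W.B 1 = 1 := by
  have h := W.B_mul 1 1
  rw [mul_one] at h
  have := W.B_pos 1
  nlinarith

theorem B_inv (x : G) : W.B x⁻¹ = (W.B x)⁻¹ := by
  have h := W.B_mul x⁻¹ x
  rw [inv_mul_cancel, B_one] at h
  exact eq_inv_of_mul_eq_one_left h.symm

theorem Y_step_le (x s : G) : W.Y (x * s) ^ 2 ≤ W.Y x ^ 2 + W.B x ^ 2 * W.m s :=
  (W.Y_mul x s).trans (by have := W.Y_le s; gcongr)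

theorem Y_le_step (x s : G) : W.Y x ^ 2 ≤ W.Y (x * s) ^ 2 + W.B x ^ 2 * W.m s := by
  have h := W.Y_mul (x * s) s⁻¹
  rw [mul_inv_cancel_right, W.B_mul, mul_pow, mul_assoc, W.Y_inv] at h
  have := W.Y_le s
  exact h.trans (by gcongr)

theorem summable_of_abs_le {g : G → ℝ} (C : ℝ) (h : ∀ s, |g s| ≤ C * W.m s ^ 8) :
    Summable fun s => W.ν s * g s := by
  refine Summable.of_norm_bounded (W.moment.mul_left C) fun s => ?_
  rw [Real.norm_eq_abs, abs_mul, abs_of_pos (W.ν_pos s)]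
  have := mul_le_mul_of_nonneg_left (h s) (W.ν_pos s).le
  linarith

theorem summable_pow {k : ℕ} (hk : k ≤ 8) : Summable fun s => W.ν s * W.m s ^ k :=
  W.summable_of_abs_le 1 fun s => by
    have := W.one_le_m s
    rw [one_mul, abs_of_nonneg (by positivity)]
    exact pow_le_pow_right₀ this hk

theorem m_le_pow (s : G) {k : ℕ} (hk : k ≠ 0) : W.m s ≤ W.m s ^ k := le_self_pow₀ (W.one_le_m s) hk

theorem tsum_inv (g : G → ℝ) : ∑' s, W.ν s * g s⁻¹ = ∑' s, W.ν s * g s := by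
  rw [← (Equiv.inv G).tsum_eq fun s => W.ν s * g s]
  exact tsum_congr fun s => by simp [W.ν_inv]

theorem abs_log_B_le (s : G) : |Real.log (W.B s)| ≤ W.m s := by
  have h1 := W.one_le_m s
  have h2 := W.B_pos s
  rw [abs_le]
  constructor
  · have := Real.one_sub_inv_le_log_of_pos h2
    have h3 : (W.B s)⁻¹ ≤ W.m s := (inv_le_iff_one_le_mul₀ h2).2 (W.one_le_mul_B s)
    linarith
  · linarith [Real.log_le_sub_one_of_pos h2, W.B_le s]

theorem summable_log_B : Summable fun s => W.ν s * Real.log (W.B s) :=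
  W.summable_of_abs_le 1 fun s => by
    rw [one_mul]; exact (W.abs_log_B_le s).trans (W.m_le_pow s (by norm_num))

theorem tsum_log_B : ∑' s, W.ν s * Real.log (W.B s) = 0 := by
  have h := W.tsum_inv fun s => Real.log (W.B s)
  simp only [B_inv, Real.log_inv, mul_neg, tsum_neg] at h
  linarith

/-- The size of a group element: comparable to `max (Y x) (B x)`. -/
noncomputable def size (R : ℝ) (x : G) : ℝ := max (W.Y x) (R * W.B x) + W.B x

theorem le_size (R : ℝ) (x : G) : (R + 1) * W.B x ≤ W.size R x := by
  have := le_max_right (W.Y x) (R * W.B x)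
  unfold size; linarith

theorem size_pos {R : ℝ} (hR : 1 ≤ R) (x : G) : 0 < W.size R x :=
  lt_of_lt_of_le (mul_pos (by linarith) (W.B_pos x)) (W.le_size R x)

theorem le_mul_size_step {R : ℝ} (hR : 1 ≤ R) (x s : G) :
    (R + 1) * W.B x ≤ W.m s * W.size R (x * s) := by
  have h1 := W.le_size R (x * s)
  have h2 := W.one_le_mul_B s
  have h3 := W.B_pos x
  have h4 := W.one_le_m s
  rw [W.B_mul] at h1
  calc (R + 1) * W.B x ≤ (R + 1) * W.B x * (W.m s * W.B s) :=
        le_mul_of_one_le_right (by positivity) h2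
    _ = W.m s * ((R + 1) * (W.B x * W.B s)) := by ring
    _ ≤ _ := by gcongr

theorem abs_size_step_le {R : ℝ} (hR : 1 ≤ R) (x s : G) :
    |W.size R (x * s) - W.size R x| ≤ (R + 1) * W.m s * W.B x := by
  unfold size
  rw [W.B_mul]
  exact max_add_step_abs_sub_le (W.B_pos x) (W.Y_nonneg _) (W.Y_nonneg _) (W.one_le_m s)
    (W.B_pos s) (W.B_le s) hR (W.Y_step_le x s) (W.Y_le_step x s)

theorem summable_log_size {R : ℝ} (hR : 1 ≤ R) (x : G) :
    Summable fun s => W.ν s * (Real.log (W.size R (x * s)) - Real.log (W.size R x)) :=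
  W.summable_of_abs_le 1 fun s => by
    have h := abs_log_sub_log_le (W.B_pos x) (W.one_le_m s) hR (W.le_size R x)
      (W.le_mul_size_step hR x s) (W.abs_size_step_le hR x s)
    rw [one_mul]
    exact h.trans (pow_le_pow_right₀ (W.one_le_m s) (by norm_num))

theorem abs_log_add_B_le {r : ℝ} (hr : 1 ≤ r) (s : G) :
    |Real.log (r + W.B s) - Real.log (r + 1)| ≤ W.m s := by
  have h1 := W.one_le_m s
  have h2 := W.B_pos s
  have h3 := W.one_le_mul_B s
  have h4 := W.B_le s
  have hp : 0 < r + W.B s := by linarith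
  have hq : 0 < r + 1 := by linarith
  rw [← Real.log_div hp.ne' hq.ne', abs_le]
  constructor
  · have := Real.one_sub_inv_le_log_of_pos (div_pos hp hq)
    have h5 : ((r + W.B s) / (r + 1))⁻¹ ≤ W.m s := by
      rw [inv_div, div_le_iff₀ hp]; nlinarith
    linarith
  · have := Real.log_le_sub_one_of_pos (div_pos hp hq)
    have h5 : (r + W.B s) / (r + 1) ≤ W.m s := by
      rw [div_le_iff₀ hq]; nlinarith
    linarith

/-- The logarithm of `r + B s` has positive drift. -/
theorem le_tsum_log_add_B {r τ : ℝ} (hr : 1 ≤ r) (t : G) (hτ0 : 0 ≤ τ)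
    (hτ : τ ≤ W.B t + (W.B t)⁻¹ - 2) :
    W.ν t * (τ / (4 + τ)) / 2 / r
      ≤ ∑' s, W.ν s * (Real.log (r + W.B s) - Real.log (r + 1)) := by
  classical
  set k : G → ℝ := fun s => Real.log (r + W.B s) - Real.log (r + 1) with hk
  have hs : Summable fun s => W.ν s * k s := W.summable_of_abs_le 1 fun s => by
    rw [one_mul]; exact (W.abs_log_add_B_le hr s).trans (W.m_le_pow s (by norm_num))
  have hs' : Summable fun s => W.ν s * k s⁻¹ := by
    rw [← (Equiv.inv G).summable_iff] at hs
    refine hs.congr fun s => ?_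
    simp [W.ν_inv]
  have h2 : ∑' s, (W.ν s * k s + W.ν s * k s⁻¹) = 2 * ∑' s, W.ν s * k s := by
    rw [hs.tsum_add hs', W.tsum_inv k]; ring
  have hpt : ∀ s, (if s = t then W.ν t * (τ / (4 + τ) / r) else 0)
      ≤ W.ν s * k s + W.ν s * k s⁻¹ := by
    intro s
    rw [← mul_add]
    split_ifs with h
    · subst h
      refine mul_le_mul_of_nonneg_left ?_ (W.ν_pos s).le
      have := log_add_symm_sum_ge hr (W.B_pos s) hτ0 hτ
      simpa [hk, B_inv] using this
    · refine mul_nonneg (W.ν_pos s).le ?_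
      have h0 : (0 : ℝ) ≤ W.B s + (W.B s)⁻¹ - 2 := by
        have := W.B_pos s
        have h5 : W.B s + (W.B s)⁻¹ - 2 = (W.B s - 1) ^ 2 / W.B s := by field_simp; ring
        rw [h5]; positivity
      have := log_add_symm_sum_ge hr (W.B_pos s) le_rfl h0
      simpa [hk, B_inv] using this
  have h3 := hasSum_le hpt (hasSum_ite_eq t _) (hs.add hs').hasSum
  rw [h2] at h3
  have h4 : W.ν t * (τ / (4 + τ)) / 2 / r = W.ν t * (τ / (4 + τ) / r) / 2 := by ring
  rw [h4]; linarith

/-- The logarithm of the size has positive drift at every point. -/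
theorem exists_drift (t : G) (ht : W.B t ≠ 1)
    (hg : ∀ K : ℝ, ∃ g, W.B g = 1 ∧ K ≤ W.Y g ^ 2) :
    ∃ R : ℝ, 1 ≤ R ∧ ∃ c : ℝ, 0 < c ∧ ∀ x, c * (W.B x / W.size R x)
      ≤ ∑' s, W.ν s * (Real.log (W.size R (x * s)) - Real.log (W.size R x)) := by
  classical
  obtain ⟨τ, hτdef⟩ : ∃ τ, τ = W.B t + (W.B t)⁻¹ - 2 := ⟨_, rfl⟩
  have hτ : 0 < τ := by
    have := W.B_pos t
    have h5 : W.B t + (W.B t)⁻¹ - 2 = (W.B t - 1) ^ 2 / W.B t := by field_simp; ring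
    have h6 : W.B t - 1 ≠ 0 := sub_ne_zero.2 ht
    rw [hτdef, h5]; positivity
  obtain ⟨c₁, hc₁def⟩ : ∃ c₁, c₁ = W.ν t * (τ / (4 + τ)) / 2 := ⟨_, rfl⟩
  have hc₁ : 0 < c₁ := by
    have := W.ν_pos t
    rw [hc₁def]; positivity
  obtain ⟨M, hM⟩ : ∃ M, M = ∑' s, W.ν s * W.m s ^ 3 := ⟨_, rfl⟩
  obtain ⟨R, hRdef⟩ : ∃ R : ℝ, R = max 1 (4 * M / c₁) := ⟨_, rfl⟩
  have hR : 1 ≤ R := hRdef ▸ le_max_left _ _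
  have hRM : 4 * M ≤ c₁ * R := by
    have : 4 * M / c₁ ≤ R := hRdef ▸ le_max_right _ _
    rw [div_le_iff₀ hc₁] at this; linarith
  obtain ⟨g, hg1, hgY⟩ := hg (5 * R ^ 2)
  have hlog : 0 < Real.log (3 / 2) := Real.log_pos (by norm_num)
  have hνg := W.ν_pos g
  refine ⟨R, hR, min (c₁ / 2) (W.ν g * Real.log (3 / 2)),
    lt_min (by positivity) (by positivity), fun x => ?_⟩
  have hb := W.B_pos x
  have hH := W.size_pos hR x
  have hsd := W.summable_log_size hR x
  have hbH : 0 < W.B x / W.size R x := by positivity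
  rcases le_or_gt (W.Y x) (R * W.B x) with hy | hy
  · have hbH1 : W.B x / W.size R x ≤ 1 := by
      rw [div_le_one hH]; nlinarith [W.le_size R x]
    have hHx : W.size R x = (R + 1) * W.B x := by
      unfold size; rw [max_eq_right hy]; ring
    have hpt : ∀ s, W.ν s * Real.log (W.B s)
        + (if s = g then W.ν g * Real.log (3 / 2) else 0)
        ≤ W.ν s * (Real.log (W.size R (x * s)) - Real.log (W.size R x)) := by
      intro s
      split_ifs with hsg
      · subst hsg
        rw [hg1, Real.log_one, mul_zero, zero_add]
        refine mul_le_mul_of_nonneg_left ?_ hνg.le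
        rw [← Real.log_div (W.size_pos hR _).ne' hH.ne']
        refine Real.log_le_log (by norm_num) ?_
        rw [le_div_iff₀ hH, hHx]
        have h1 := W.Y_mul x⁻¹ (x * s)
        have h2 := W.Y_inv x
        rw [inv_mul_cancel_left, B_inv] at h1
        have h3 : W.B x ^ 2 * W.Y s ^ 2 ≤ W.Y x ^ 2 + W.Y (x * s) ^ 2 := by
          calc W.B x ^ 2 * W.Y s ^ 2
              ≤ W.B x ^ 2 * (W.Y x⁻¹ ^ 2 + (W.B x)⁻¹ ^ 2 * W.Y (x * s) ^ 2) := by gcongr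
            _ = W.B x ^ 2 * W.Y x⁻¹ ^ 2 + W.Y (x * s) ^ 2 := by field_simp
            _ = _ := by rw [h2]
        have h4 : W.Y x ^ 2 ≤ (R * W.B x) ^ 2 := by
          have := W.Y_nonneg x
          gcongr
        have h5 : W.B x ^ 2 * (5 * R ^ 2) ≤ W.B x ^ 2 * W.Y s ^ 2 := by gcongr
        have h6 : 2 * (R * W.B x) ≤ W.Y (x * s) := by
          refine (pow_le_pow_iff_left₀ (by positivity) (W.Y_nonneg _) two_ne_zero).1 ?_
          nlinarith
        have h7 : W.Y (x * s) + W.B x ≤ W.size R (x * s) := by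
          unfold size
          rw [W.B_mul, hg1, mul_one]
          gcongr
          exact le_max_left _ _
        nlinarith
      · rw [add_zero]
        refine mul_le_mul_of_nonneg_left ?_ (W.ν_pos s).le
        rw [hHx, ← Real.log_div (W.size_pos hR _).ne' (by positivity)]
        refine Real.log_le_log (W.B_pos s) ?_
        rw [le_div_iff₀ (by positivity)]
        have := W.le_size R (x * s)
        rw [W.B_mul] at this
        linarith
    have h := hasSum_le hpt ((W.summable_log_B.hasSum).add (hasSum_ite_eq g _)) hsd.hasSum
    rw [W.tsum_log_B, zero_add] at h
    refine le_trans ?_ h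
    calc min (c₁ / 2) (W.ν g * Real.log (3 / 2)) * (W.B x / W.size R x)
        ≤ (W.ν g * Real.log (3 / 2)) * 1 := by
          gcongr
          exact min_le_right _ _
      _ = _ := mul_one _
  · obtain ⟨r, hr⟩ : ∃ r, r = W.Y x / W.B x := ⟨_, rfl⟩
    have hYr : W.Y x = W.B x * r := by rw [hr]; field_simp
    have hRr : R < r := by rw [hr, lt_div_iff₀ hb]; exact hy
    have hr1 : 1 ≤ r := by linarith
    have hr0 : 0 < r := by linarith
    have hHx : W.size R x = W.B x * (r + 1) := by
      unfold size; rw [max_eq_left hy.le, hYr]; ring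
    have hpt : ∀ s, W.ν s * (Real.log (r + W.B s) - Real.log (r + 1))
        - 2 / r ^ 2 * (W.ν s * W.m s ^ 3)
        ≤ W.ν s * (Real.log (W.size R (x * s)) - Real.log (W.size R x)) := by
      intro s
      have hs0 := W.B_pos s
      have e1 : W.Y (x * s) = W.B x * (W.Y (x * s) / W.B x) := by field_simp
      have hr' : 0 ≤ W.Y (x * s) / W.B x := div_nonneg (W.Y_nonneg _) hb.le
      generalize W.Y (x * s) / W.B x = r' at e1 hr'
      have h1 : r ^ 2 ≤ r' ^ 2 + W.m s := by
        have h2 := W.Y_le_step x s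
        rw [hYr, e1] at h2
        have : W.B x ^ 2 * r ^ 2 ≤ W.B x ^ 2 * (r' ^ 2 + W.m s) := by linarith
        exact le_of_mul_le_mul_left this (by positivity)
      have h3 := log_add_sub_log_add_ge hr1 hr' (W.one_le_m s) (W.one_le_mul_B s) h1
      have h4 : Real.log (W.B x) + Real.log (r' + W.B s) ≤ Real.log (W.size R (x * s)) := by
        rw [← Real.log_mul hb.ne' (by positivity)]
        refine Real.log_le_log (by positivity) ?_
        unfold size
        rw [W.B_mul, mul_add, ← e1]
        gcongr
        exact le_max_left _ _
      rw [hHx, Real.log_mul hb.ne' (by positivity)]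
      have h5 : Real.log (r + W.B s) - Real.log (r + 1) - 2 / r ^ 2 * W.m s ^ 3
          ≤ Real.log (W.size R (x * s)) - (Real.log (W.B x) + Real.log (r + 1)) := by
        have : 2 / r ^ 2 * W.m s ^ 3 = 2 * W.m s ^ 3 / r ^ 2 := by ring
        linarith
      have := mul_le_mul_of_nonneg_left h5 (W.ν_pos s).le
      linarith
    have hk : Summable fun s => W.ν s * (Real.log (r + W.B s) - Real.log (r + 1)) :=
      W.summable_of_abs_le 1 fun s => by
        rw [one_mul]; exact (W.abs_log_add_B_le hr1 s).trans (W.m_le_pow s (by norm_num))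
    have h := hasSum_le hpt (hk.hasSum.sub
      (((W.summable_pow (k := 3) (by norm_num)).hasSum).mul_left _)) hsd.hasSum
    have hdr := W.le_tsum_log_add_B hr1 t hτ.le hτdef.le
    rw [← hc₁def] at hdr
    rw [← hM] at h
    refine le_trans ?_ h
    have hbHr : W.B x / W.size R x ≤ 1 / r := by
      rw [hHx, div_le_div_iff₀ (by positivity) hr0]
      nlinarith
    have hM2 : 2 / r ^ 2 * M ≤ c₁ / 2 / r := by
      have : 4 * M ≤ c₁ * r := hRM.trans (by gcongr)
      rw [div_mul_eq_mul_div, div_div, div_le_div_iff₀ (by positivity) (by positivity)]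
      nlinarith
    have : min (c₁ / 2) (W.ν g * Real.log (3 / 2)) * (W.B x / W.size R x)
        ≤ c₁ / 2 * (1 / r) := by
      gcongr
      exact min_le_left _ _
    have e : c₁ / r = c₁ / 2 * (1 / r) + c₁ / 2 / r := by field_simp; norm_num
    linarith

end SimilarityWalk

namespace SimilarityWalk

variable {G : Type*} [Group G] (W : SimilarityWalk G)

theorem summable_of_bounded {g : G → ℝ} (C : ℝ) (h : ∀ s, |g s| ≤ C) :
    Summable fun s => W.ν s * g s :=
  W.summable_of_abs_le C fun s => (h s).trans
    (le_mul_of_one_le_right ((abs_nonneg _).trans (h s)) (one_le_pow₀ (W.one_le_m s)))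

/-- A positive logarithmic drift yields a bounded strictly superharmonic function. -/
theorem exists_bounded_superharmonic {R c₀ : ℝ} (hR : 1 ≤ R) (hc₀ : 0 < c₀)
    (hdrift : ∀ x, c₀ * (W.B x / W.size R x)
      ≤ ∑' s, W.ν s * (Real.log (W.size R (x * s)) - Real.log (W.size R x))) :
    ∃ w : G → ℝ, ∃ c : ℝ, 0 < c ∧ (∀ x, 0 ≤ w x) ∧ (∀ x, w x ≤ 1) ∧
      ∀ x, ∑' s, W.ν s * w (x * s) ≤ w x - c * (W.B x / (1 + W.size R x) ^ 2) := by
  obtain ⟨M, hM⟩ : ∃ M, M = ∑' s, W.ν s * W.m s ^ 8 := ⟨_, rfl⟩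
  have hM0 : 0 < M := by
    have h := hasSum_le (fun s => le_mul_of_one_le_right (W.ν_pos s).le
      (one_le_pow₀ (W.one_le_m s) (n := 8))) W.ν_hasSum W.moment.hasSum
    rw [hM]; linarith
  obtain ⟨C, hC⟩ : ∃ C, C = 8 * (R + 1) ^ 2 * M := ⟨_, rfl⟩
  have hC0 : 0 < C := by rw [hC]; positivity
  obtain ⟨ε, hεdef⟩ : ∃ ε, ε = min 1 (c₀ / (2 * C)) := ⟨_, rfl⟩
  have hε0 : 0 < ε := hεdef ▸ lt_min one_pos (by positivity)
  have hε1 : ε ≤ 1 := hεdef ▸ min_le_left _ _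
  have hεC : ε * C ≤ c₀ / 2 := by
    have : ε ≤ c₀ / (2 * C) := hεdef ▸ min_le_right _ _
    rw [le_div_iff₀ (by positivity)] at this
    linarith
  have hw0 : ∀ x, 0 ≤ 1 / (1 + W.size R x ^ ε) := fun x => by
    have := W.size_pos hR x
    positivity
  have hw1 : ∀ x, 1 / (1 + W.size R x ^ ε) ≤ 1 := fun x => by
    have h := Real.rpow_pos_of_pos (W.size_pos hR x) ε
    rw [div_le_one (by positivity)]; linarith
  refine ⟨fun x => 1 / (1 + W.size R x ^ ε), ε * c₀ / 8, by positivity, hw0, hw1, fun x => ?_⟩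
  have hb := W.B_pos x
  have hH := W.size_pos hR x
  have hpow := Real.rpow_pos_of_pos hH ε
  obtain ⟨a, ha⟩ : ∃ a, a = W.size R x ^ ε / (1 + W.size R x ^ ε) ^ 2 := ⟨_, rfl⟩
  have ha0 : 0 < a := by rw [ha]; positivity
  have hpt : ∀ s, W.ν s * (1 / (1 + W.size R (x * s) ^ ε))
      ≤ W.ν s * (1 / (1 + W.size R x ^ ε))
        + ((-(a * ε)) * (W.ν s * (Real.log (W.size R (x * s)) - Real.log (W.size R x)))
        + (a * ε ^ 2 * (8 * (R + 1) ^ 2) * (W.B x / W.size R x)) * (W.ν s * W.m s ^ 8)) := by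
    intro s
    have h1 := logistic_rpow_le hH (W.size_pos hR (x * s)) ε
    have h2 := exp_neg_log_div_le hb (W.one_le_m s) hR hε0.le hε1 (W.le_size R x)
      (W.le_mul_size_step hR x s) (W.abs_size_step_le hR x s)
    rw [← ha] at h1
    have h3 := mul_le_mul_of_nonneg_left h2 ha0.le
    have h4 : 1 / (1 + W.size R (x * s) ^ ε) ≤ 1 / (1 + W.size R x ^ ε)
        + (-(a * ε) * (Real.log (W.size R (x * s)) - Real.log (W.size R x))
        + (a * ε ^ 2 * (8 * (R + 1) ^ 2) * (W.B x / W.size R x)) * W.m s ^ 8) := by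
      linarith
    have := mul_le_mul_of_nonneg_left h4 (W.ν_pos s).le
    linarith
  have hsum : Summable fun s => W.ν s * (1 / (1 + W.size R (x * s) ^ ε)) :=
    W.summable_of_bounded 1 fun s => by rw [abs_of_nonneg (hw0 _)]; exact hw1 _
  have h := hasSum_le hpt hsum.hasSum
    ((W.ν_hasSum.mul_right _).add
      (((W.summable_log_size hR x).hasSum.mul_left _).add (W.moment.hasSum.mul_left _)))
  rw [← hM, one_mul] at h
  refine h.trans ?_
  have h1 := mul_le_mul_of_nonneg_left (hdrift x) (mul_pos ha0 hε0).le
  have h2 := logistic_rpow_derivative_ge hH hε0.le hε1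
  rw [← ha] at h2
  have hbH : 0 < W.B x / W.size R x := by positivity
  have h3 : (a * ε * (W.B x / W.size R x)) * (ε * C)
      ≤ (a * ε * (W.B x / W.size R x)) * (c₀ / 2) := by gcongr
  have h4 : (ε * c₀ / 2 * W.B x) * (1 / (4 * (1 + W.size R x) ^ 2))
      ≤ (ε * c₀ / 2 * W.B x) * (a / W.size R x) := by gcongr
  have e4 : (ε * c₀ / 2 * W.B x) * (1 / (4 * (1 + W.size R x) ^ 2))
      = ε * c₀ / 8 * (W.B x / (1 + W.size R x) ^ 2) := by field_simp; norm_num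
  have e5 : (ε * c₀ / 2 * W.B x) * (a / W.size R x)
      = a * ε * (W.B x / W.size R x) * (c₀ / 2) := by ring
  rw [hC] at h3
  linarith

theorem summable_cuspProfile (x : G) :
    Summable fun s => W.ν s * cuspProfile (W.B (x * s)) (W.Y (x * s)) :=
  W.summable_of_abs_le (|Real.log (W.B x)| + 1) fun s => by
    rw [abs_of_nonneg (cuspProfile_nonneg _ _)]
    have h1 := cuspProfile_le_abs_log (W.B (x * s)) (W.Y (x * s))
    rw [W.B_mul, Real.log_mul (W.B_pos x).ne' (W.B_pos s).ne', ← W.B_mul] at h1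
    have h2 := abs_add_le (Real.log (W.B x)) (Real.log (W.B s))
    have h3 := (W.abs_log_B_le s).trans (W.m_le_pow s (k := 8) (by norm_num))
    have h4 := le_mul_of_one_le_right (abs_nonneg (Real.log (W.B x)))
      (one_le_pow₀ (W.one_le_m s) (n := 8))
    linarith

/-- The profile is harmonic up to a small error. -/
theorem exists_abs_tsum_cuspProfile_sub_le {R : ℝ} (hR : 1 ≤ R) : ∃ C : ℝ, 0 ≤ C ∧ ∀ x,
    |∑' s, W.ν s * cuspProfile (W.B (x * s)) (W.Y (x * s)) - cuspProfile (W.B x) (W.Y x)|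
      ≤ C * (W.B x / (1 + W.size R x) ^ 2) := by
  refine ⟨3 * (R + 4) ^ 2 * ∑' s, W.ν s * W.m s ^ 6, ?_, fun x => ?_⟩
  · have : 0 ≤ ∑' s, W.ν s * W.m s ^ 6 := tsum_nonneg fun s =>
      mul_nonneg (W.ν_pos s).le (pow_nonneg (by linarith [W.one_le_m s]) _)
    positivity
  obtain ⟨k, hk⟩ : ∃ k : ℝ, k = if W.B x ≤ 1 then max 0 (1 - W.Y x ^ 2) else 0 := ⟨_, rfl⟩
  have hstep := fun s => abs_le.1 (abs_cuspProfile_step_le (W.B_pos x) (W.Y_nonneg x) (W.one_le_m s)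
    (W.B_pos s) (W.B_le s) (W.one_le_mul_B s) hR (W.Y_step_le x s) (W.Y_le_step x s))
  simp only [← hk, ← W.B_mul] at hstep
  have hmid := ((W.summable_cuspProfile x).hasSum.sub
    (W.ν_hasSum.mul_right (cuspProfile (W.B x) (W.Y x)))).add (W.summable_log_B.hasSum.mul_left k)
  have hrhs := (W.summable_pow (k := 6) (by norm_num)).hasSum.mul_left
    (3 * (R + 4) ^ 2 * (W.B x / (1 + W.size R x) ^ 2))
  have hu := hasSum_le (fun s => ?_) hmid hrhs
  have hl := hasSum_le (fun s => ?_) hrhs.neg hmid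
  · rw [W.tsum_log_B] at hu hl
    rw [abs_le]
    constructor <;> linarith
  · have := mul_le_mul_of_nonneg_left (hstep s).1 (W.ν_pos s).le
    unfold size
    linarith
  · have := mul_le_mul_of_nonneg_left (hstep s).2 (W.ν_pos s).le
    unfold size
    linarith

/-- There is a nonnegative harmonic function at bounded distance from the profile. -/
theorem exists_harmonic_near_cuspProfile (t : G) (ht : W.B t ≠ 1)
    (hg : ∀ K : ℝ, ∃ g, W.B g = 1 ∧ K ≤ W.Y g ^ 2) :
    ∃ f : G → ℝ, ∃ C : ℝ, (∀ x, 0 ≤ f x) ∧ (∀ x, Summable fun s => W.ν s * f (x * s)) ∧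
      (∀ x, f x = ∑' s, W.ν s * f (x * s)) ∧
      ∀ x, |f x - cuspProfile (W.B x) (W.Y x)| ≤ C := by
  obtain ⟨R, hR, c₀, hc₀, hdrift⟩ := W.exists_drift t ht hg
  obtain ⟨w, c, hc, hw0, hw1, hw⟩ := W.exists_bounded_superharmonic hR hc₀ hdrift
  obtain ⟨C, hC, hψ⟩ := W.exists_abs_tsum_cuspProfile_sub_le hR
  obtain ⟨k, hk⟩ : ∃ k, k = C / c := ⟨_, rfl⟩
  have hk0 : 0 ≤ k := by rw [hk]; positivity
  have hkc : k * c = C := by rw [hk]; field_simp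
  have hsw : ∀ x, Summable fun s => W.ν s * w (x * s) := fun x =>
    W.summable_of_bounded 1 fun s => by rw [abs_of_nonneg (hw0 _)]; exact hw1 _
  have hplus := fun x => (W.summable_cuspProfile x).hasSum.add ((hsw x).hasSum.mul_left k)
  have hminus := fun x => (W.summable_cuspProfile x).hasSum.sub ((hsw x).hasSum.mul_left k)
  have e1 : ∀ x s, W.ν s * cuspProfile (W.B (x * s)) (W.Y (x * s)) + k * (W.ν s * w (x * s))
      = W.ν s * (cuspProfile (W.B (x * s)) (W.Y (x * s)) + k * w (x * s)) := fun x s => by ring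
  have e2 : ∀ x s, W.ν s * cuspProfile (W.B (x * s)) (W.Y (x * s)) - k * (W.ν s * w (x * s))
      = W.ν s * (cuspProfile (W.B (x * s)) (W.Y (x * s)) - k * w (x * s)) := fun x s => by ring
  simp only [e1] at hplus
  simp only [e2] at hminus
  have hkw : ∀ x, k * ∑' s, W.ν s * w (x * s)
      ≤ k * w x - C * (W.B x / (1 + W.size R x) ^ 2) := fun x => by
    have := mul_le_mul_of_nonneg_left (hw x) hk0
    rw [mul_sub, ← mul_assoc, hkc] at this
    exact this
  have hkw0 : ∀ x, 0 ≤ k * w x := fun x => mul_nonneg hk0 (hw0 x)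
  obtain ⟨f, hf0, hlo, hhi, hfs, hf⟩ := exists_harmonic_between W.ν (fun s => (W.ν_pos s).le)
    (fun x => cuspProfile (W.B x) (W.Y x) - k * w x)
    (fun x => cuspProfile (W.B x) (W.Y x) + k * w x)
    (fun x => by linarith [hkw0 x])
    (fun x => add_nonneg (cuspProfile_nonneg _ _) (hkw0 x))
    (fun x => (hplus x).summable) (fun x => (hminus x).summable)
    (fun x => by
      rw [(hplus x).tsum_eq]
      linarith [(abs_le.1 (hψ x)).2, hkw x])
    (fun x => by
      rw [(hminus x).tsum_eq]
      linarith [(abs_le.1 (hψ x)).1, hkw x])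
  refine ⟨f, k, hf0, hfs, hf, fun x => ?_⟩
  have := mul_le_mul_of_nonneg_left (hw1 x) hk0
  rw [abs_le]
  constructor <;> linarith [hlo x, hhi x]

end SimilarityWalk

/-- Convolution of weights on a group. -/
noncomputable def weightConv {G : Type*} [Group G] (f g : G → ENNReal) (s : G) : ENNReal :=
  ∑' t, f t * g (t⁻¹ * s)

theorem weightConv_assoc {G : Type*} [Group G] (f g h : G → ENNReal) :
    weightConv f (weightConv g h) = weightConv (weightConv f g) h := by
  ext s
  unfold weightConv
  calc ∑' t, f t * ∑' u, g u * h (u⁻¹ * (t⁻¹ * s))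
      = ∑' t, ∑' v, f t * (g (t⁻¹ * v) * h (v⁻¹ * s)) := by
        refine tsum_congr fun t => ?_
        rw [← ENNReal.tsum_mul_left, ← (Equiv.mulLeft t⁻¹).tsum_eq]
        simp [mul_assoc]
    _ = ∑' v, (∑' t, f t * g (t⁻¹ * v)) * h (v⁻¹ * s) := by
        rw [ENNReal.tsum_comm]
        refine tsum_congr fun v => ?_
        rw [← ENNReal.tsum_mul_right]
        simp only [mul_assoc]

theorem weightConv_inv {G : Type*} [Group G] {f g : G → ENNReal} (hf : ∀ s, f s⁻¹ = f s)
    (hg : ∀ s, g s⁻¹ = g s) (s : G) : weightConv f g s⁻¹ = weightConv g f s := by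
  unfold weightConv
  rw [← (Equiv.mulLeft s⁻¹).tsum_eq]
  refine tsum_congr fun u => ?_
  have e1 : f (s⁻¹ * u) = f (u⁻¹ * s) := by rw [← hf]; simp
  have e2 : g ((s⁻¹ * u)⁻¹ * s⁻¹) = g u := by rw [← hg]; simp
  simp only [Equiv.coe_mulLeft, e1, e2, mul_comm]

theorem tsum_weightConv_mul {G : Type*} [Group G] (f g φ : G → ENNReal) :
    ∑' s, weightConv f g s * φ s = ∑' t, f t * ∑' u, g u * φ (t * u) := by
  unfold weightConv
  simp only [← ENNReal.tsum_mul_right, ← ENNReal.tsum_mul_left]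
  rw [ENNReal.tsum_comm]
  refine tsum_congr fun t => ?_
  rw [← (Equiv.mulLeft t).tsum_eq]
  simp [mul_assoc]

/-- The weights of the `k`-th step of the walk with step weights `μ`. -/
noncomputable def weightPow {G : Type*} [Group G] (μ : G → ENNReal) : ℕ → G → ENNReal
  | 0 => Set.indicator {1} 1
  | k + 1 => weightConv μ (weightPow μ k)

theorem weightConv_pow_comm {G : Type*} [Group G] (μ : G → ENNReal) (k : ℕ) :
    weightConv μ (weightPow μ k) = weightConv (weightPow μ k) μ := by
  induction k with
  | zero =>
    ext s
    unfold weightConv weightPow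
    rw [tsum_eq_single s, tsum_eq_single 1]
    · simp
    · intro t ht
      simp [ht]
    · intro t ht
      have : t⁻¹ * s ≠ 1 := fun h => ht (inv_mul_eq_one.1 h)
      simp [this]
  | succ k ih =>
    change weightConv μ (weightConv μ (weightPow μ k)) = weightConv (weightConv μ (weightPow μ k)) μ
    rw [← weightConv_assoc, ← ih]

theorem weightPow_inv {G : Type*} [Group G] {μ : G → ENNReal} (hμ : ∀ s, μ s⁻¹ = μ s) (k : ℕ)
    (s : G) : weightPow μ k s⁻¹ = weightPow μ k s := by
  induction k generalizing s with
  | zero => by_cases h : s = 1 <;> simp [weightPow, h]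
  | succ k ih =>
    change weightConv μ (weightPow μ k) s⁻¹ = weightConv μ (weightPow μ k) s
    rw [weightConv_inv hμ ih, weightConv_pow_comm]

theorem tsum_weightPow {G : Type*} [Group G] {μ : G → ENNReal} (hμ : ∑' s, μ s = 1) (k : ℕ) :
    ∑' s, weightPow μ k s = 1 := by
  induction k with
  | zero =>
    rw [tsum_eq_single 1]
    · simp [weightPow]
    · intro t ht
      simp [weightPow, ht]
  | succ k ih =>
    have := tsum_weightConv_mul μ (weightPow μ k) 1
    simp only [Pi.one_apply, mul_one, ih, hμ] at this
    exact this

theorem tsum_weightPow_mul_le {G : Type*} [Group G] {μ φ : G → ENNReal} {c : ENNReal}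
    (hφ1 : φ 1 ≤ 1) (hφ : ∀ s t, φ (s * t) ≤ φ s * φ t) (hμφ : ∑' s, μ s * φ s ≤ c) (k : ℕ) :
    ∑' s, weightPow μ k s * φ s ≤ c ^ k := by
  induction k with
  | zero =>
    rw [tsum_eq_single 1]
    · simpa [weightPow] using hφ1
    · intro t ht
      simp [weightPow, ht]
  | succ k ih =>
    calc ∑' s, weightPow μ (k + 1) s * φ s
        = ∑' t, μ t * ∑' u, weightPow μ k u * φ (t * u) := tsum_weightConv_mul _ _ _
      _ ≤ ∑' t, μ t * φ t * c ^ k := by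
          refine ENNReal.tsum_le_tsum fun t => ?_
          rw [mul_assoc]
          gcongr
          refine le_trans ?_ (mul_le_mul_right ih (φ t))
          rw [← ENNReal.tsum_mul_left]
          refine ENNReal.tsum_le_tsum fun u => ?_
          refine (mul_le_mul_right (hφ t u) _).trans (le_of_eq (by ring))
      _ ≤ c ^ (k + 1) := by
          rw [ENNReal.tsum_mul_right, pow_succ']
          gcongr

/-- The step weights of the walk sampled at a geometric time. -/
noncomputable def weightGeom {G : Type*} [Group G] (μ : G → ENNReal) (s : G) : ENNReal :=
  ∑' k : ℕ, 2⁻¹ ^ (k + 1) * weightPow μ k s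

theorem weightGeom_inv {G : Type*} [Group G] {μ : G → ENNReal} (hμ : ∀ s, μ s⁻¹ = μ s) (s : G) :
    weightGeom μ s⁻¹ = weightGeom μ s := by
  unfold weightGeom
  simp only [weightPow_inv hμ]

theorem tsum_weightGeom {G : Type*} [Group G] {μ : G → ENNReal} (hμ : ∑' s, μ s = 1) :
    ∑' s, weightGeom μ s = 1 := by
  unfold weightGeom
  rw [ENNReal.tsum_comm]
  simp only [ENNReal.tsum_mul_left, tsum_weightPow hμ, mul_one]
  rw [ENNReal.tsum_geometric_add_one, ENNReal.one_sub_inv_two, inv_inv]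
  exact ENNReal.inv_mul_cancel (by norm_num) (by norm_num)

theorem weightGeom_eq {G : Type*} [Group G] (μ : G → ENNReal) (s : G) :
    weightGeom μ s = 2⁻¹ * weightPow μ 0 s + 2⁻¹ * weightConv μ (weightGeom μ) s := by
  unfold weightGeom
  rw [tsum_eq_zero_add' ENNReal.summable, zero_add, pow_one]
  congr 1
  have : weightConv μ (fun s => ∑' k : ℕ, 2⁻¹ ^ (k + 1) * weightPow μ k s) s
      = ∑' k : ℕ, 2⁻¹ ^ (k + 1) * weightPow μ (k + 1) s := by
    change ∑' t, μ t * ∑' k : ℕ, 2⁻¹ ^ (k + 1) * weightPow μ k (t⁻¹ * s)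
      = ∑' k : ℕ, 2⁻¹ ^ (k + 1) * ∑' t, μ t * weightPow μ k (t⁻¹ * s)
    simp only [← ENNReal.tsum_mul_left]
    rw [ENNReal.tsum_comm]
    refine tsum_congr fun k => tsum_congr fun t => by ring
  rw [this, ← ENNReal.tsum_mul_left]
  refine tsum_congr fun k => by ring

theorem weightGeom_pos {G : Type*} [Group G] {μ : G → ENNReal} (hμ : ∀ s, μ s⁻¹ = μ s)
    (hgen : Subgroup.closure {s | μ s ≠ 0} = ⊤) (s : G) : 0 < weightGeom μ s := by
  have hstep : ∀ t s, μ t ≠ 0 → 0 < weightGeom μ s → 0 < weightGeom μ (t * s) := by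
    intro t s ht hs
    rw [weightGeom_eq]
    have h1 : μ t * weightGeom μ (t⁻¹ * (t * s)) ≤ weightConv μ (weightGeom μ) (t * s) :=
      ENNReal.le_tsum (f := fun t' => μ t' * weightGeom μ (t'⁻¹ * (t * s))) t
    rw [inv_mul_cancel_left] at h1
    have h2 : 0 < μ t * weightGeom μ s := ENNReal.mul_pos ht hs.ne'
    have h3 : 0 < 2⁻¹ * weightConv μ (weightGeom μ) (t * s) :=
      ENNReal.mul_pos (by norm_num) (h2.trans_le h1).ne'
    exact h3.trans_le le_add_self
  have hs : s ∈ Subgroup.closure {s | μ s ≠ 0} := hgen ▸ Subgroup.mem_top s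
  induction hs using Subgroup.closure_induction_left with
  | one =>
    rw [weightGeom_eq]
    have : (0 : ENNReal) < 2⁻¹ * weightPow μ 0 (1 : G) := by simp [weightPow]
    exact this.trans_le le_self_add
  | mul_left x hx y _ ih => exact hstep x y hx ih
  | inv_mul_cancel x hx y _ ih => exact hstep x⁻¹ y (by rw [hμ]; exact hx) ih

theorem tsum_weightGeom_mul_lt_top {G : Type*} [Group G] {μ φ : G → ENNReal}
    (hφ1 : φ 1 ≤ 1) (hφ : ∀ s t, φ (s * t) ≤ φ s * φ t)
    (hμφ : ∑' s, μ s * φ s ≤ 3 / 2) : ∑' s, weightGeom μ s * φ s < ⊤ := by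
  unfold weightGeom
  simp only [← ENNReal.tsum_mul_right]
  rw [ENNReal.tsum_comm]
  have : ∀ k : ℕ, ∑' s, 2⁻¹ ^ (k + 1) * weightPow μ k s * φ s ≤ (3 / 4) ^ k := by
    intro k
    simp only [mul_assoc]
    rw [ENNReal.tsum_mul_left, pow_succ, mul_assoc]
    calc (2⁻¹ : ENNReal) ^ k * (2⁻¹ * ∑' s, weightPow μ k s * φ s)
        ≤ 2⁻¹ ^ k * (1 * (3 / 2) ^ k) := by
          gcongr
          · simp
          · exact tsum_weightPow_mul_le hφ1 hφ hμφ k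
      _ = (2⁻¹ * (3 / 2)) ^ k := by rw [one_mul, mul_pow]
      _ = _ := by
          congr 1
          rw [← ENNReal.toReal_eq_toReal_iff' (by finiteness) (by finiteness)]
          simp
          norm_num
  refine (ENNReal.tsum_le_tsum this).trans_lt ?_
  rw [ENNReal.tsum_geometric, ENNReal.inv_lt_top, tsub_pos_iff_lt]
  rw [ENNReal.div_lt_iff (by norm_num) (by norm_num)]
  norm_num

/-- Nonnegative functions harmonic for the sampled walk are harmonic for the original one. -/
theorem weightGeom_harmonic {G : Type*} [Group G] {μ : G → ENNReal} {F : G → ENNReal}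
    (hF : ∀ x, F x ≠ ⊤) (h : ∀ x, F x = ∑' s, weightGeom μ s * F (x * s)) (x : G) :
    F x = ∑' t, μ t * F (x * t) := by
  have h1 : F x = 2⁻¹ * F x + 2⁻¹ * ∑' t, μ t * F (x * t) := by
    calc F x = ∑' s, (2⁻¹ * weightPow μ 0 s + 2⁻¹ * weightConv μ (weightGeom μ) s) * F (x * s) := by
          rw [h]; simp only [← weightGeom_eq]
      _ = 2⁻¹ * ∑' s, weightPow μ 0 s * F (x * s)
          + 2⁻¹ * ∑' s, weightConv μ (weightGeom μ) s * F (x * s) := by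
          simp only [add_mul, mul_assoc]
          rw [ENNReal.tsum_add, ENNReal.tsum_mul_left, ENNReal.tsum_mul_left]
      _ = _ := by
          congr 2
          · rw [tsum_eq_single 1]
            · simp [weightPow]
            · intro t ht
              simp [weightPow, ht]
          · rw [tsum_weightConv_mul μ (weightGeom μ) fun s => F (x * s)]
            refine tsum_congr fun t => ?_
            rw [h (x * t)]
            simp only [mul_assoc]
  have h2 : 2⁻¹ * F x + 2⁻¹ * F x = 2⁻¹ * F x + 2⁻¹ * ∑' t, μ t * F (x * t) := by
    rw [← h1, ← add_mul, ENNReal.inv_two_add_inv_two, one_mul]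
  have h3 := (ENNReal.add_right_inj (ENNReal.mul_ne_top (by norm_num) (hF x))).1 h2
  exact (ENNReal.mul_right_inj (by norm_num) (by norm_num)).1 h3

theorem ofReal_hasSum {ι : Type*} {f : ι → ℝ} {a : ℝ} (hf : ∀ i, 0 ≤ f i) (h : HasSum f a) :
    ∑' i, ENNReal.ofReal (f i) = ENNReal.ofReal a := by
  rw [← h.tsum_eq, ENNReal.ofReal_tsum_of_nonneg hf h.summable]

/-- A courteous random walk can be replaced by one with full support whose nonnegative harmonic
functions are harmonic for the original walk. -/
theorem exists_full_support_weights {G : Type*} [Group G] {μ L : G → ℝ} {ζ : ℝ}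
    (h0 : ∀ x, 0 ≤ μ x) (h1 : HasSum μ 1) (hsym : ∀ x, μ x⁻¹ = μ x)
    (hgen : Subgroup.closure {x | μ x ≠ 0} = ⊤) (hL1 : L 1 = 0)
    (hL : ∀ x y, L (x * y) ≤ L x + L y) (hζ : 0 < ζ)
    (hsum : Summable fun x => μ x * Real.exp (ζ * L x)) :
    ∃ ν : G → ℝ, ∃ κ : ℝ, 0 < κ ∧ (∀ s, 0 < ν s) ∧ HasSum ν 1 ∧ (∀ s, ν s⁻¹ = ν s) ∧
      (Summable fun s => ν s * Real.exp (κ * L s)) ∧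
      ∀ f : G → ℝ, (∀ x, 0 ≤ f x) → (∀ x, Summable fun s => ν s * f (x * s)) →
        (∀ x, f x = ∑' s, ν s * f (x * s)) → ∀ x, f x = ∑' s, μ s * f (x * s⁻¹) := by
  obtain ⟨K, hK⟩ := hsum
  obtain ⟨n, hn⟩ := exists_nat_gt (max 1 (2 * K))
  have hn1 : (1 : ℝ) < n := (le_max_left _ _).trans_lt hn
  have hn2 : 2 * K < n := (le_max_right _ _).trans_lt hn
  have hn0 : (0 : ℝ) < n := by linarith
  obtain ⟨κ, hκ⟩ : ∃ κ, κ = ζ / n := ⟨_, rfl⟩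
  have hκ0 : 0 < κ := by rw [hκ]; positivity
  have hbern : ∀ s, Real.exp (κ * L s) ≤ 1 - 1 / n + 1 / n * Real.exp (ζ * L s) := by
    intro s
    have e : Real.exp (ζ * L s) = (1 + (Real.exp (κ * L s) - 1)) ^ n := by
      rw [add_sub_cancel, ← Real.exp_nat_mul, hκ]
      congr 1; field_simp
    have h := one_add_mul_le_pow (a := Real.exp (κ * L s) - 1)
      (by linarith [Real.exp_pos (κ * L s)]) n
    rw [← e] at h
    have h2 := mul_le_mul_of_nonneg_left h (by positivity : 0 ≤ 1 / (n : ℝ))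
    have h3 : 1 / (n : ℝ) * (1 + n * (Real.exp (κ * L s) - 1))
        = 1 / n + (Real.exp (κ * L s) - 1) := by field_simp
    linarith
  obtain ⟨M, hM⟩ : ∃ M : G → ENNReal, ∀ s, M s = ENNReal.ofReal (μ s) := ⟨_, fun _ => rfl⟩
  obtain ⟨φ, hφ⟩ : ∃ φ : G → ENNReal, ∀ s, φ s = ENNReal.ofReal (Real.exp (κ * L s)) :=
    ⟨_, fun _ => rfl⟩
  have hM1 : ∑' s, M s = 1 := by
    simp only [hM]; rw [ofReal_hasSum h0 h1, ENNReal.ofReal_one]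
  have hMs : ∀ s, M s⁻¹ = M s := fun s => by rw [hM, hM, hsym]
  have hMgen : Subgroup.closure {s | M s ≠ 0} = ⊤ := by
    rw [← hgen]
    congr 1
    ext s
    simp only [Set.mem_ofPred_eq, hM, ne_eq, ENNReal.ofReal_eq_zero, not_le]
    exact ⟨fun h => h.ne', fun h => lt_of_le_of_ne (h0 s) (Ne.symm h)⟩
  have hφ1 : φ 1 ≤ 1 := by simp [hφ, hL1]
  have hφm : ∀ s t, φ (s * t) ≤ φ s * φ t := fun s t => by
    rw [hφ, hφ, hφ, ← ENNReal.ofReal_mul (Real.exp_pos _).le, ← Real.exp_add]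
    refine ENNReal.ofReal_le_ofReal (Real.exp_le_exp.2 ?_)
    nlinarith [hL s t]
  have hMφ : ∑' s, M s * φ s ≤ 3 / 2 := by
    have hs := (h1.mul_right (1 - 1 / (n : ℝ))).add (hK.mul_left (1 / (n : ℝ)))
    have hn' : (0 : ℝ) ≤ 1 - 1 / n := by
      rw [sub_nonneg, div_le_one hn0]; exact hn1.le
    have hs' := ofReal_hasSum (fun s => by have := h0 s; positivity) hs
    have h3 : ENNReal.ofReal (1 * (1 - 1 / (n : ℝ)) + 1 / n * K) ≤ 3 / 2 := by
      have : (3 / 2 : ENNReal) = ENNReal.ofReal (3 / 2) := by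
        rw [ENNReal.ofReal_div_of_pos (by norm_num)]; norm_num
      rw [this]
      refine ENNReal.ofReal_le_ofReal ?_
      have h4 : 1 / (n : ℝ) * K ≤ 1 / 2 := by
        rw [one_div_mul_eq_div, div_le_div_iff₀ hn0 two_pos]; linarith
      have h5 : 0 < 1 / (n : ℝ) := by positivity
      linarith
    refine le_trans (ENNReal.tsum_le_tsum fun s => ?_) (hs'.le.trans h3)
    rw [hM, hφ, ← ENNReal.ofReal_mul (h0 s)]
    refine ENNReal.ofReal_le_ofReal ?_
    have := mul_le_mul_of_nonneg_left (hbern s) (h0 s)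
    linarith
  have hN1 := tsum_weightGeom hM1
  have hNtop : ∀ s, weightGeom M s ≠ ⊤ := fun s =>
    ENNReal.ne_top_of_tsum_ne_top (by rw [hN1]; exact ENNReal.one_ne_top) s
  have hNpos := weightGeom_pos hMs hMgen
  have hof : ∀ s, ENNReal.ofReal (weightGeom M s).toReal = weightGeom M s := fun s =>
    ENNReal.ofReal_toReal (hNtop s)
  refine ⟨fun s => (weightGeom M s).toReal, κ, hκ0,
    fun s => ENNReal.toReal_pos (hNpos s).ne' (hNtop s), ?_, fun s => ?_, ?_, ?_⟩
  · have h := ENNReal.hasSum_toReal (f := weightGeom M) (by rw [hN1]; exact ENNReal.one_ne_top)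
    rwa [← ENNReal.tsum_toReal_eq hNtop, hN1, ENNReal.toReal_one] at h
  · simp only [weightGeom_inv hMs]
  · have h := ENNReal.summable_toReal (tsum_weightGeom_mul_lt_top hφ1 hφm hMφ).ne
    refine h.congr fun s => ?_
    rw [ENNReal.toReal_mul, hφ, ENNReal.toReal_ofReal (Real.exp_pos _).le]
  · intro f hf0 hfs hf x
    have hF := weightGeom_harmonic (μ := M) (F := fun x => ENNReal.ofReal (f x))
      (fun _ => ENNReal.ofReal_ne_top) (fun x => by
        have h := ofReal_hasSum
          (fun s => mul_nonneg ENNReal.toReal_nonneg (hf0 (x * s))) (hfs x).hasSum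
        rw [← hf x] at h
        rw [← h]
        refine tsum_congr fun s => ?_
        rw [ENNReal.ofReal_mul ENNReal.toReal_nonneg, hof]) x
    have h2 := congrArg ENNReal.toReal hF
    rw [ENNReal.toReal_ofReal (hf0 x), ENNReal.tsum_toReal_eq fun s =>
      ENNReal.mul_ne_top (by rw [hM]; exact ENNReal.ofReal_ne_top) ENNReal.ofReal_ne_top] at h2
    rw [h2, ← (Equiv.inv G).tsum_eq fun s => (M s * ENNReal.ofReal (f (x * s))).toReal]
    refine tsum_congr fun s => ?_
    simp only [Equiv.inv_apply]
    rw [hMs, hM, ENNReal.toReal_mul, ENNReal.toReal_ofReal (h0 s), ENNReal.toReal_ofReal (hf0 _)]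

section WordLength

variable {G : Type*} [Group G] {S : Finset G}

theorem exists_list_of_wordLen (hgen : Subgroup.closure (S : Set G) = ⊤)
    (hsym : ∀ s ∈ S, s⁻¹ ∈ S) (x : G) :
    ∃ l : List G, (∀ s ∈ l, s ∈ (S : Set G)) ∧ l.length = wordLen (S : Set G) x ∧ l.prod = x := by
  have hne : {n : ℕ | ∃ l : List G, (∀ s ∈ l, s ∈ (S : Set G)) ∧ l.length = n ∧
      l.prod = x}.Nonempty := by
    have hx : x ∈ Subgroup.closure (S : Set G) := hgen ▸ Subgroup.mem_top x
    induction hx using Subgroup.closure_induction_left with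
    | one => exact ⟨0, [], by simp⟩
    | mul_left y hy z _ ih =>
      obtain ⟨n, l, hl, hn, hp⟩ := ih
      refine ⟨n + 1, y :: l, ?_, by simp [hn], by simp [hp]⟩
      simpa using ⟨hy, hl⟩
    | inv_mul_cancel y hy z _ ih =>
      obtain ⟨n, l, hl, hn, hp⟩ := ih
      refine ⟨n + 1, y⁻¹ :: l, ?_, by simp [hn], by simp [hp]⟩
      simpa using ⟨hsym y hy, hl⟩
  exact Nat.sInf_mem hne

theorem wordLen_prod_le {l : List G} (hl : ∀ s ∈ l, s ∈ (S : Set G)) :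
    wordLen (S : Set G) l.prod ≤ l.length :=
  Nat.sInf_le ⟨l, hl, rfl, rfl⟩

theorem wordLen_one : wordLen (S : Set G) 1 = 0 := by
  simpa using wordLen_prod_le (S := S) (l := []) (by simp)

theorem wordLen_mul_le (hgen : Subgroup.closure (S : Set G) = ⊤)
    (hsym : ∀ s ∈ S, s⁻¹ ∈ S) (x y : G) :
    wordLen (S : Set G) (x * y) ≤ wordLen (S : Set G) x + wordLen (S : Set G) y := by
  obtain ⟨l, hl, hn, rfl⟩ := exists_list_of_wordLen hgen hsym x
  obtain ⟨l', hl', hn', rfl⟩ := exists_list_of_wordLen hgen hsym y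
  rw [← hn, ← hn', ← List.prod_append, ← List.length_append]
  refine wordLen_prod_le fun s hs => ?_
  rcases List.mem_append.1 hs with h | h
  · exact hl s h
  · exact hl' s h

theorem wordLen_induction (hgen : Subgroup.closure (S : Set G) = ⊤)
    (hsym : ∀ s ∈ S, s⁻¹ ∈ S) {p : ℕ → G → Prop} (h1 : p 0 1)
    (hmul : ∀ s ∈ S, ∀ n x, p n x → p (n + 1) (s * x)) (x : G) :
    p (wordLen (S : Set G) x) x := by
  obtain ⟨l, hl, hn, rfl⟩ := exists_list_of_wordLen hgen hsym x
  rw [← hn]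
  clear hn
  induction l with
  | nil => simpa using h1
  | cons s l ih =>
    rw [List.length_cons, List.prod_cons]
    exact hmul s (hl s (by simp)) _ _ (ih fun u hu => hl u (by simp [hu]))

/-- Similarity ratios and lengths grow at most exponentially with the word length. -/
theorem exists_exponential_bound (hgen : Subgroup.closure (S : Set G) = ⊤)
    (hsym : ∀ s ∈ S, s⁻¹ ∈ S) {α Q : G → ℝ} (hα : ∀ x, 0 < α x)
    (hαm : ∀ x y, α (x * y) = α x * α y) (hQ0 : ∀ x, 0 ≤ Q x)
    (hQ : ∀ x y, Q (x * y) ≤ Q x + α x * Q y) :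
    ∃ C : ℝ, 0 ≤ C ∧ ∀ x, |Real.log (α x)| ≤ C * wordLen (S : Set G) x ∧
      Q x ≤ (1 + Q 1) * Real.exp (C * wordLen (S : Set G) x) := by
  have hterm : ∀ s, 0 ≤ Real.log (1 + Q s) + |Real.log (α s)| := fun s =>
    add_nonneg (Real.log_nonneg (by linarith [hQ0 s])) (abs_nonneg _)
  obtain ⟨C, hC⟩ : ∃ C, C = ∑ s ∈ S, (Real.log (1 + Q s) + |Real.log (α s)|) := ⟨_, rfl⟩
  have hC0 : 0 ≤ C := hC ▸ Finset.sum_nonneg fun s _ => hterm s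
  have hle : ∀ s ∈ S, Real.log (1 + Q s) + |Real.log (α s)| ≤ C := fun s hs => by
    rw [hC]; exact Finset.single_le_sum (fun s _ => hterm s) hs
  have hα1 : α 1 = 1 := by
    have h := hαm 1 1
    rw [mul_one] at h
    nlinarith [hα 1]
  refine ⟨C, hC0, fun x => ⟨?_, ?_⟩⟩
  · refine wordLen_induction hgen hsym
      (p := fun n x => |Real.log (α x)| ≤ C * n) (by simp [hα1]) (fun s hs n x ih => ?_) x
    rw [hαm, Real.log_mul (hα s).ne' (hα x).ne']
    have h1 := hle s hs
    have h2 : 0 ≤ Real.log (1 + Q s) := Real.log_nonneg (by linarith [hQ0 s])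
    refine (abs_add_le _ _).trans ?_
    push_cast
    linarith
  · have key : Q x ≤ (1 + Q 1) * Real.exp (C * wordLen (S : Set G) x) - 1 := by
      refine wordLen_induction hgen hsym
        (p := fun n x => Q x ≤ (1 + Q 1) * Real.exp (C * n) - 1) (by simp)
        (fun s hs n x ih => ?_) x
      have h1 := hle s hs
      have h2 : 0 ≤ Real.log (1 + Q s) := Real.log_nonneg (by linarith [hQ0 s])
      have h3 : 1 + Q s ≤ Real.exp C := by
        rw [← Real.log_le_iff_le_exp (by linarith [hQ0 s])]
        linarith [abs_nonneg (Real.log (α s))]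
      have h4 : α s ≤ Real.exp C := by
        rw [← Real.log_le_iff_le_exp (hα s)]
        linarith [le_abs_self (Real.log (α s))]
      have h5 : Real.exp (C * ((n + 1 : ℕ) : ℝ)) = Real.exp C * Real.exp (C * n) := by
        rw [← Real.exp_add]; congr 1; push_cast; ring
      rw [h5]
      have h6 : α s * Q x ≤ Real.exp C * ((1 + Q 1) * Real.exp (C * n) - 1) :=
        mul_le_mul h4 ih (hQ0 x) (Real.exp_pos _).le
      linarith [hQ s x]
    linarith

theorem polyNormR_one_lt_top {f : G → ℝ} {C D : ℝ} (hC : 0 ≤ C) (hD : 0 ≤ D)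
    (h : ∀ x, |f x| ≤ C * wordLen (S : Set G) x + D) : polyNormR (S : Set G) 1 f < ⊤ := by
  unfold polyNormR
  refine lt_of_le_of_lt (b := ENNReal.ofReal (C + D)) ?_ ENNReal.ofReal_lt_top
  refine Filter.limsup_le_of_le (by isBoundedDefault) ?_
  filter_upwards [Filter.eventually_ge_atTop 1] with r hr
  have hr' : (1 : ℝ) ≤ r := by exact_mod_cast hr
  rw [pow_one, ENNReal.inv_mul_le_iff (by exact_mod_cast (by omega : r ≠ 0)) (by simp)]
  refine iSup₂_le fun x hx => ?_
  have hx' : (wordLen (S : Set G) x : ℝ) ≤ r := by exact_mod_cast hx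
  rw [← ENNReal.ofReal_natCast, ← ENNReal.ofReal_mul (by linarith)]
  have h2 : ((‖f x‖₊ : NNReal) : ENNReal) = ENNReal.ofReal |f x| := by
    rw [← Real.norm_eq_abs, ofReal_norm]; rfl
  rw [h2]
  refine ENNReal.ofReal_le_ofReal ((h x).trans ?_)
  nlinarith

end WordLength

section SimilarityLength

variable {G : Type*} [Group G] {β q : G → ℝ}

theorem similarityRatio_one (hβ : ∀ x, 0 < β x) (hβm : ∀ x y, β (x * y) = β x * β y) :
    β 1 = 1 := by
  have h := hβm 1 1
  rw [mul_one] at h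
  have := hβ 1
  nlinarith

theorem similarityRatio_inv (hβ : ∀ x, 0 < β x) (hβm : ∀ x y, β (x * y) = β x * β y) (x : G) :
    β x⁻¹ = (β x)⁻¹ := by
  have h := hβm x⁻¹ x
  rw [inv_mul_cancel, similarityRatio_one hβ hβm] at h
  exact eq_inv_of_mul_eq_one_left h.symm

theorem similarityRatio_pow (hβ : ∀ x, 0 < β x) (hβm : ∀ x y, β (x * y) = β x * β y) (x : G)
    (n : ℕ) : β (x ^ n) = β x ^ n := by
  induction n with
  | zero => simp [similarityRatio_one hβ hβm]
  | succ n ih => rw [pow_succ, hβm, ih, pow_succ]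

theorem similarityLength_inv_eq_zero (hβ : ∀ x, 0 < β x)
    (hqi : ∀ x, β x * q x⁻¹ = q x) {t : G} (ht : q t = 0) : q t⁻¹ = 0 := by
  have h := hqi t
  rw [ht] at h
  exact (mul_eq_zero.1 h).resolve_left (hβ t).ne'

theorem similarityLength_pow_eq_zero (hβ : ∀ x, 0 < β x) (hq0 : ∀ x, 0 ≤ q x)
    (hq : ∀ x y, q (x * y) ≤ q x + β x * q y) (hqi : ∀ x, β x * q x⁻¹ = q x) {t : G}
    (ht : q t = 0) (k : ℕ) : q (t ^ k) = 0 := by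
  have ht' := similarityLength_inv_eq_zero hβ hqi ht
  induction k with
  | zero =>
    have := hq t t⁻¹
    rw [mul_inv_cancel, ht, ht'] at this
    rw [pow_zero]
    exact le_antisymm (by simpa using this) (hq0 1)
  | succ k ih =>
    refine le_antisymm ?_ (hq0 _)
    have := hq (t ^ k) t
    rw [pow_succ]
    simpa [ih, ht] using this

theorem similarityLength_mul_left (hβ : ∀ x, 0 < β x) (hβm : ∀ x y, β (x * y) = β x * β y)
    (hq : ∀ x y, q (x * y) ≤ q x + β x * q y) (hqi : ∀ x, β x * q x⁻¹ = q x) {u : G}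
    (hu : q u = 0) (y : G) : q (u * y) = β u * q y := by
  refine le_antisymm (by simpa [hu] using hq u y) ?_
  have h := hq u⁻¹ (u * y)
  rw [inv_mul_cancel_left, similarityLength_inv_eq_zero hβ hqi hu, zero_add,
    similarityRatio_inv hβ hβm] at h
  rwa [← le_inv_mul_iff₀ (hβ u)]

theorem similarityLength_mul_right (hβ : ∀ x, 0 < β x)
    (hq : ∀ x y, q (x * y) ≤ q x + β x * q y) (hqi : ∀ x, β x * q x⁻¹ = q x) {v : G}
    (hv : q v = 0) (y : G) : q (y * v) = q y := by
  refine le_antisymm (by simpa [hv] using hq y v) ?_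
  have h := hq (y * v) v⁻¹
  rwa [mul_inv_cancel_right, similarityLength_inv_eq_zero hβ hqi hv, mul_zero, add_zero] at h

/-- A contracting element fixing the base point and an element moving it produce isometries
whose orbit of the base point is uniformly separated and unbounded. -/
theorem exists_separated_isometries (hβ : ∀ x, 0 < β x) (hβm : ∀ x y, β (x * y) = β x * β y)
    (hq0 : ∀ x, 0 ≤ q x) (hq : ∀ x y, q (x * y) ≤ q x + β x * q y)
    (hqi : ∀ x, β x * q x⁻¹ = q x) {t s : G} (ht1 : β t < 1) (ht : q t = 0) (hs : q s ≠ 0) :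
    ∃ g : ℕ → G, (∀ i, β (g i) = 1) ∧ (∀ K, ∃ i, K ≤ q (g i)) ∧
      ∀ i j, i ≠ j → ∀ k, 1 ≤ q ((g i)⁻¹ * g j * t ^ k) := by
  have hθ := hβ t
  have hs0 : 0 < q s := lt_of_le_of_ne (hq0 s) (Ne.symm hs)
  obtain ⟨a, ha⟩ : ∃ a, a = s * (t⁻¹ * s⁻¹) * t := ⟨_, rfl⟩
  have hβa : β a = 1 := by
    have h1 := hβ s
    rw [ha]; simp only [hβm, similarityRatio_inv hβ hβm]; field_simp
  have hθ1 : 1 < (β t)⁻¹ := (one_lt_inv₀ hθ).2 ht1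
  have hqa : 0 < q a := by
    rw [ha, similarityLength_mul_right hβ hq hqi ht]
    have h1 := hq s⁻¹ (s * (t⁻¹ * s⁻¹))
    rw [inv_mul_cancel_left, similarityLength_mul_left hβ hβm hq hqi
      (similarityLength_inv_eq_zero hβ hqi ht), similarityRatio_inv hβ hβm,
      similarityRatio_inv hβ hβm] at h1
    have h2 := mul_le_mul_of_nonneg_left h1 (hβ s).le
    have h3 : β s * ((β t)⁻¹ * q s⁻¹) = (β t)⁻¹ * q s := by rw [← hqi s]; ring
    have h4 : β s * (q s⁻¹ + (β s)⁻¹ * q (s * (t⁻¹ * s⁻¹))) = q s + q (s * (t⁻¹ * s⁻¹)) := by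
      have := (hβ s).ne'
      rw [mul_add, hqi]; field_simp
    rw [h3, h4] at h2
    nlinarith
  obtain ⟨N, hN⟩ := pow_unbounded_of_one_lt (1 + 1 / q a) hθ1
  obtain ⟨ρ, hρ⟩ : ∃ ρ, ρ = (β t)⁻¹ ^ N := ⟨_, rfl⟩
  rw [← hρ] at hN
  have hinv : 0 < 1 / q a := by positivity
  have hρ1 : 1 < ρ := by linarith
  have hρA : 1 ≤ (ρ - 1) * q a := by
    rw [← div_le_iff₀ hqa]; linarith
  obtain ⟨g, hg⟩ : ∃ g : ℕ → G, ∀ i, g i = (t ^ (N * i))⁻¹ * a * t ^ (N * i) := ⟨_, fun _ => rfl⟩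
  have hβg : ∀ i, β (g i) = 1 := fun i => by
    have := hβ (t ^ (N * i))
    rw [hg]; simp only [hβm, similarityRatio_inv hβ hβm, hβa]; field_simp
  have hqt := similarityLength_pow_eq_zero hβ hq0 hq hqi ht
  have hqg : ∀ i, q (g i) = ρ ^ i * q a := fun i => by
    rw [hg, similarityLength_mul_right hβ hq hqi (hqt _),
      similarityLength_mul_left hβ hβm hq hqi (similarityLength_inv_eq_zero hβ hqi (hqt _)),
      similarityRatio_inv hβ hβm, similarityRatio_pow hβ hβm, hρ, ← pow_mul, inv_pow]
  have hsep : ∀ i j, i < j → 1 ≤ q (g j) - q (g i) := fun i j hij => by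
    have h1 : ρ ^ (i + 1) ≤ ρ ^ j := pow_le_pow_right₀ hρ1.le hij
    have h2 : 1 ≤ ρ ^ i := one_le_pow₀ hρ1.le
    rw [hqg, hqg]
    calc (1 : ℝ) ≤ 1 * ((ρ - 1) * q a) := by rw [one_mul]; exact hρA
      _ ≤ ρ ^ i * ((ρ - 1) * q a) := by gcongr
      _ = ρ ^ (i + 1) * q a - ρ ^ i * q a := by ring
      _ ≤ _ := by gcongr
  have hdiff : ∀ i j, q (g j) - q (g i) ≤ q ((g i)⁻¹ * g j) := fun i j => by
    have h := hq (g i) ((g i)⁻¹ * g j)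
    rw [mul_inv_cancel_left, hβg, one_mul] at h
    linarith
  refine ⟨g, hβg, fun K => ?_, fun i j hij k => ?_⟩
  · obtain ⟨i, hi⟩ := pow_unbounded_of_one_lt (K / q a) hρ1
    refine ⟨i, ?_⟩
    rw [hqg, ← div_le_iff₀ hqa]
    exact hi.le
  · rw [similarityLength_mul_right hβ hq hqi (hqt k)]
    rcases lt_or_gt_of_ne hij with h | h
    · exact (hsep i j h).trans (hdiff i j)
    · have h1 := (hsep j i h).trans (hdiff j i)
      have h2 := hqi ((g j)⁻¹ * g i)
      have h3 : β ((g j)⁻¹ * g i) = 1 := by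
        simp [hβm, similarityRatio_inv hβ hβm, hβg]
      rw [h3, one_mul, mul_inv_rev, inv_inv] at h2
      rwa [h2]

end SimilarityLength

/-- Translates of a function which is close to a linear function along separated rays span an
infinite-dimensional space. -/
theorem not_exists_finiteDimensional_translates {G : Type*} [Group G] {f : G → ℝ} {C L : ℝ}
    (hL : 0 < L) {g : ℕ → G} {t : G} (hsame : ∀ i, ∀ k : ℕ, k * L - C ≤ f ((g i)⁻¹ * g i * t ^ k))
    (hdiff : ∀ i j, i ≠ j → ∀ k, |f ((g i)⁻¹ * g j * t ^ k)| ≤ C) :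
    ¬ ∃ W : Submodule ℝ (G → ℝ), FiniteDimensional ℝ W ∧
        ∀ x : G, (fun y : G => f (x⁻¹ * y)) ∈ W := by
  rintro ⟨W, hW, hmem⟩
  have hC : 0 ≤ C := (abs_nonneg _).trans (hdiff 0 1 (by norm_num) 0)
  have hlin : LinearIndependent ℝ fun i : ℕ => (fun y : G => f ((g i)⁻¹ * y)) := by
    rw [linearIndependent_iff']
    intro S c hc j hj
    by_contra hcj
    have hcj' : 0 < |c j| := abs_pos.2 hcj
    obtain ⟨D, hD⟩ : ∃ D, D = ∑ i ∈ S.erase j, |c i| * C := ⟨_, rfl⟩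
    obtain ⟨k, hk⟩ := exists_nat_gt ((D / |c j| + C) / L)
    rw [div_lt_iff₀ hL] at hk
    have h := congrFun hc (g j * t ^ k)
    simp only [Finset.sum_apply, Pi.smul_apply, smul_eq_mul, Pi.zero_apply, ← mul_assoc] at h
    rw [← Finset.add_sum_erase _ _ hj] at h
    have h1 : |∑ i ∈ S.erase j, c i * f ((g i)⁻¹ * g j * t ^ k)| ≤ D := by
      rw [hD]
      refine (Finset.abs_sum_le_sum_abs _ _).trans (Finset.sum_le_sum fun i hi => ?_)
      rw [abs_mul]
      exact mul_le_mul_of_nonneg_left (hdiff i j (Finset.ne_of_mem_erase hi) k) (abs_nonneg _)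
    have h2 : |c j| * |f ((g j)⁻¹ * g j * t ^ k)| ≤ D := by
      rw [← abs_mul]
      have : c j * f ((g j)⁻¹ * g j * t ^ k)
          = -∑ i ∈ S.erase j, c i * f ((g i)⁻¹ * g j * t ^ k) := by linarith
      rw [this, abs_neg]
      exact h1
    have h3 : |f ((g j)⁻¹ * g j * t ^ k)| ≤ D / |c j| := by
      rw [le_div_iff₀ hcj']; linarith
    linarith [hsame j k, le_abs_self (f ((g j)⁻¹ * g j * t ^ k))]
  have h : LinearIndependent ℝ fun i : ℕ => (⟨_, hmem (g i)⟩ : W) :=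
    LinearIndependent.of_comp W.subtype hlin
  have := h.finite
  exact not_finite ℕ

theorem rpow_half_sq {a : ℝ} (ha : 0 ≤ a) (η : ℝ) : (a ^ (η / 2)) ^ 2 = a ^ η := by
  rw [← Real.rpow_natCast, ← Real.rpow_mul ha]
  congr 1
  push_cast
  ring

/-- The theorem for a group acting on a pseudometric space by similarities, where some strict
similarity fixes a base point that is moved by another element. -/
theorem exists_harmonic_of_similarityLength {G : Type*} [Group G] {S : Finset G}
    (hSgen : Subgroup.closure (S : Set G) = ⊤) (hSsym : ∀ s ∈ S, s⁻¹ ∈ S)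
    {μ : G → ℝ} (hnonneg : ∀ x, 0 ≤ μ x) (hprob : HasSum μ 1) (hsym : ∀ x : G, μ x⁻¹ = μ x)
    (hadapted : Subgroup.closure {x : G | μ x ≠ 0} = ⊤)
    (hsmooth : ∃ ζ : ℝ, 0 < ζ ∧
      Summable (fun x : G => μ x * Real.exp (ζ * (wordLen (S : Set G) x))))
    {α Q : G → ℝ} (hα : ∀ x, 0 < α x) (hαm : ∀ x y, α (x * y) = α x * α y)
    (hQ0 : ∀ x, 0 ≤ Q x) (hQ : ∀ x y, Q (x * y) ≤ Q x + α x * Q y)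
    (hQi : ∀ x, α x * Q x⁻¹ = Q x) {t s : G} (ht1 : α t ≠ 1) (ht : Q t = 0) (hs : Q s ≠ 0) :
    ∃ f : G → ℝ, (∀ x, 0 ≤ f x) ∧ (∀ x : G, f x = ∑' s : G, μ s * f (x * s⁻¹)) ∧
      polyNormR (S : Set G) 1 f < ⊤ ∧
      ¬ ∃ W : Submodule ℝ (G → ℝ), FiniteDimensional ℝ W ∧
        ∀ x : G, (fun y : G => f (x⁻¹ * y)) ∈ W := by
  wlog ht1' : α t < 1 generalizing t
  · have h1 := similarityRatio_inv hα hαm t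
    have h2 : 1 < α t := lt_of_le_of_ne (not_lt.1 ht1') (Ne.symm ht1)
    have h3 : α t⁻¹ < 1 := by rw [h1]; exact inv_lt_one_of_one_lt₀ h2
    exact this h3.ne (similarityLength_inv_eq_zero hα hQi ht) h3
  obtain ⟨C, hC, hbound⟩ := exists_exponential_bound hSgen hSsym hα hαm hQ0 hQ
  have hQ1 : Q 1 = 0 := by simpa using similarityLength_pow_eq_zero hα hQ0 hQ hQi ht 0
  rw [hQ1] at hbound
  obtain ⟨ζ, hζ, hζs⟩ := hsmooth
  obtain ⟨ν, κ, hκ, hν, hν1, hνi, hνs, hνμ⟩ := exists_full_support_weights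
    (L := fun x => (wordLen (S : Set G) x : ℝ)) hnonneg hprob hsym hadapted
    (by simp [wordLen_one]) (fun x y => by exact_mod_cast wordLen_mul_le hSgen hSsym x y) hζ hζs
  obtain ⟨η, hη⟩ : ∃ η, η = min 1 (κ / (8 * C + 8)) := ⟨_, rfl⟩
  have hη0 : 0 < η := hη ▸ lt_min one_pos (by positivity)
  have hη1 : η ≤ 1 := hη ▸ min_le_left _ _
  have hηκ : 8 * (η * C) ≤ κ := by
    have : η ≤ κ / (8 * C + 8) := hη ▸ min_le_right _ _
    rw [le_div_iff₀ (by positivity)] at this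
    nlinarith
  have hsq := fun {a : ℝ} (ha : 0 ≤ a) => rpow_half_sq ha η
  obtain ⟨m, hm⟩ : ∃ m : G → ℝ, ∀ x, m x = Real.exp (η * C * wordLen (S : Set G) x) :=
    ⟨_, fun _ => rfl⟩
  have hpos : ∀ x, 0 ≤ C * wordLen (S : Set G) x := fun x => by positivity
  let W : SimilarityWalk G :=
    { ν := ν
      B := fun x => α x ^ (η / 2)
      Y := fun x => Q x ^ (η / 2)
      m := m
      ν_pos := hν
      ν_hasSum := hν1
      ν_inv := hνi
      B_pos := fun x => Real.rpow_pos_of_pos (hα x) _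
      B_mul := fun x y => by rw [hαm, Real.mul_rpow (hα x).le (hα y).le]
      Y_nonneg := fun x => Real.rpow_nonneg (hQ0 x) _
      Y_mul := fun x y => by
        rw [hsq (hQ0 _), hsq (hQ0 _), hsq (hQ0 _), hsq (hα _).le,
          ← Real.mul_rpow (hα x).le (hQ0 y)]
        exact (Real.rpow_le_rpow (hQ0 _) (hQ x y) hη0.le).trans
          (Real.rpow_add_le_add_rpow (hQ0 x) (mul_nonneg (hα x).le (hQ0 y)) hη0.le hη1)
      Y_inv := fun x => by
        rw [hsq (hQ0 _), hsq (hQ0 _), hsq (hα _).le, ← Real.mul_rpow (hα x).le (hQ0 _), hQi]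
      one_le_m := fun s => by
        rw [hm]; exact Real.one_le_exp (by positivity)
      B_le := fun s => by
        rw [hm, Real.rpow_def_of_pos (hα s)]
        refine Real.exp_le_exp.2 ?_
        nlinarith [(abs_le.1 (hbound s).1).2, hpos s]
      one_le_mul_B := fun s => by
        rw [hm, Real.rpow_def_of_pos (hα s), ← Real.exp_add]
        refine Real.one_le_exp ?_
        nlinarith [(abs_le.1 (hbound s).1).1, hpos s]
      Y_le := fun s => by
        rw [hsq (hQ0 s), hm, mul_assoc, mul_comm, Real.exp_mul]
        refine Real.rpow_le_rpow (hQ0 s) ?_ hη0.le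
        simpa using (hbound s).2
      moment := by
        refine Summable.of_nonneg_of_le (fun s => mul_nonneg (hν s).le ?_) (fun s => ?_) hνs
        · rw [hm]; positivity
        · rw [hm, ← Real.exp_nat_mul]
          refine mul_le_mul_of_nonneg_left (Real.exp_le_exp.2 ?_) (hν s).le
          have := mul_le_mul_of_nonneg_right hηκ (Nat.cast_nonneg (wordLen (S : Set G) s))
          push_cast
          linarith }
  have hWB : ∀ x, W.B x = α x ^ (η / 2) := fun _ => rfl
  have hWY : ∀ x, W.Y x = Q x ^ (η / 2) := fun _ => rfl
  have hWt : W.B t < 1 := Real.rpow_lt_one (hα t).le ht1' (by positivity)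
  have hYt : W.Y t ^ 2 = 0 := by
    rw [hWY, hsq (hQ0 t), ht, Real.zero_rpow hη0.ne']
  have hYs : W.Y s ^ 2 ≠ 0 := by
    rw [hWY, hsq (hQ0 s)]
    exact (Real.rpow_pos_of_pos (lt_of_le_of_ne (hQ0 s) (Ne.symm hs)) _).ne'
  obtain ⟨g, hg1, hgK, hgsep⟩ := exists_separated_isometries (β := fun x => W.B x ^ 2)
    (q := fun x => W.Y x ^ 2) (fun x => pow_pos (W.B_pos x) 2)
    (fun x y => by rw [W.B_mul, mul_pow]) (fun x => sq_nonneg _) W.Y_mul W.Y_inv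
    (t := t) (s := s) (pow_lt_one₀ (W.B_pos t).le hWt two_ne_zero) hYt hYs
  have hgB : ∀ i, W.B (g i) = 1 := fun i =>
    (pow_eq_one_iff_of_nonneg (W.B_pos _).le two_ne_zero).1 (hg1 i)
  obtain ⟨f, D, hf0, hfs, hfh, hfD⟩ := W.exists_harmonic_near_cuspProfile t hWt.ne fun K =>
    (hgK K).imp' g fun i hi => ⟨hgB i, hi⟩
  have hD : 0 ≤ D := (abs_nonneg _).trans (hfD 1)
  refine ⟨f, hf0, hνμ f hf0 hfs hfh, ?_, ?_⟩
  · refine polyNormR_one_lt_top hC hD fun x => ?_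
    have h1 := (abs_le.1 (hfD x)).2
    have h2 := cuspProfile_le_abs_log (W.B x) (W.Y x)
    have h3 : |Real.log (W.B x)| ≤ C * wordLen (S : Set G) x := by
      rw [hWB, Real.log_rpow (hα x), abs_mul, abs_of_nonneg (by positivity)]
      have := (hbound x).1
      nlinarith [abs_nonneg (Real.log (α x))]
    rw [abs_of_nonneg (hf0 x)]
    linarith
  · refine not_exists_finiteDimensional_translates (C := D) (L := -Real.log (W.B t)) (g := g)
      (t := t) (neg_pos.2 (Real.log_neg (W.B_pos t) hWt)) (fun i k => ?_) fun i j hij k => ?_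
    · rw [inv_mul_cancel, one_mul]
      have h1 := (abs_le.1 (hfD (t ^ k))).1
      have h2 : W.Y (t ^ k) ^ 2 = 0 :=
        similarityLength_pow_eq_zero (β := fun x => W.B x ^ 2) (q := fun x => W.Y x ^ 2)
          (fun x => pow_pos (W.B_pos x) 2) (fun x => sq_nonneg _) W.Y_mul W.Y_inv hYt k
      have h3 : k * -Real.log (W.B t) ≤ cuspProfile (W.B (t ^ k)) (W.Y (t ^ k)) := by
        unfold cuspProfile
        rw [h2, similarityRatio_pow W.B_pos W.B_mul, Real.log_pow, sub_zero,
          max_eq_right zero_le_one, mul_one, mul_neg]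
        exact le_max_right _ _
      linarith
    · have h1 := hfD ((g i)⁻¹ * g j * t ^ k)
      have h2 : cuspProfile (W.B ((g i)⁻¹ * g j * t ^ k)) (W.Y ((g i)⁻¹ * g j * t ^ k)) = 0 := by
        unfold cuspProfile
        rw [max_eq_left (sub_nonpos.2 (hgsep i j hij k)), mul_zero]
      rwa [h2, sub_zero] at h1

/-- The exponential growth rate of `z` compared with powers of `γ`: the infimum of all
`exp (p / n)` such that `z ^ n ≤ γ ^ p`. -/
noncomputable def growthRate {Γ : Type*} [LinearOrderedCommGroupWithZero Γ] (γ z : Γ) : ℝ :=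
  sInf {r : ℝ | ∃ (n : ℕ) (p : ℤ), 0 < n ∧ z ^ n ≤ γ ^ p ∧ r = Real.exp (p / n)}

section growthRate

variable {Γ : Type*} [LinearOrderedCommGroupWithZero Γ] {γ y z : Γ}

lemma growthRate_nonneg (γ z : Γ) : 0 ≤ growthRate γ z :=
  Real.sInf_nonneg (by rintro _ ⟨n, p, -, -, rfl⟩; positivity)

lemma growthRate_le {n : ℕ} {p : ℤ} (hn : 0 < n) (h : z ^ n ≤ γ ^ p) :
    growthRate γ z ≤ Real.exp (p / n) :=
  csInf_le ⟨0, by rintro _ ⟨n, p, -, -, rfl⟩; positivity⟩ ⟨n, p, hn, h, rfl⟩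

lemma le_growthRate {b : ℝ} (hz : ∃ p : ℤ, z ≤ γ ^ p)
    (h : ∀ (n : ℕ) (p : ℤ), 0 < n → z ^ n ≤ γ ^ p → b ≤ Real.exp (p / n)) :
    b ≤ growthRate γ z := by
  obtain ⟨p, hp⟩ := hz
  refine le_csInf ⟨_, 1, p, one_pos, by simpa using hp, rfl⟩ ?_
  rintro _ ⟨n, p, hn, hnp, rfl⟩
  exact h n p hn hnp

lemma growthRate_mono (hz : ∃ p : ℤ, z ≤ γ ^ p) (hyz : y ≤ z) :
    growthRate γ y ≤ growthRate γ z :=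
  le_growthRate hz fun _ _ hn h => growthRate_le hn ((pow_le_pow_left₀ zero_le hyz _).trans h)

lemma growthRate_mul_le (hγ : γ ≠ 0) (hy : ∃ p : ℤ, y ≤ γ ^ p) (hz : ∃ p : ℤ, z ≤ γ ^ p) :
    growthRate γ (y * z) ≤ growthRate γ y * growthRate γ z := by
  have key : ∀ (n m : ℕ) (p q : ℤ), 0 < n → 0 < m → y ^ n ≤ γ ^ p → z ^ m ≤ γ ^ q →
      growthRate γ (y * z) ≤ Real.exp (p / n) * Real.exp (q / m) := by
    intro n m p q hn hm hp hq
    have h : (y * z) ^ (n * m) ≤ γ ^ (p * m + q * n) := by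
      rw [mul_pow, pow_mul, mul_comm n m, pow_mul z, zpow_add₀ hγ, zpow_mul, zpow_mul,
        zpow_natCast, zpow_natCast]
      exact mul_le_mul' (pow_le_pow_left₀ zero_le hp _) (pow_le_pow_left₀ zero_le hq _)
    refine (growthRate_le (Nat.mul_pos hn hm) h).trans_eq ?_
    rw [← Real.exp_add]
    have : (n : ℝ) ≠ 0 := by positivity
    have : (m : ℝ) ≠ 0 := by positivity
    congr 1
    push_cast
    field_simp
  have key' : ∀ (n : ℕ) (p : ℤ), 0 < n → y ^ n ≤ γ ^ p →
      growthRate γ (y * z) ≤ Real.exp (p / n) * growthRate γ z := by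
    intro n p hn hp
    rw [← div_le_iff₀' (Real.exp_pos _)]
    exact le_growthRate hz fun m q hm hq => by
      rw [div_le_iff₀' (Real.exp_pos _)]
      exact key n m p q hn hm hp hq
  rcases (growthRate_nonneg γ z).eq_or_lt with h0 | h0
  · obtain ⟨p, hp⟩ := hy
    simpa [← h0] using key' 1 p one_pos (by simpa using hp)
  · rw [← div_le_iff₀ h0]
    exact le_growthRate hy fun n p hn hp => by
      rw [div_le_iff₀ h0]
      exact key' n p hn hp

lemma one_le_growthRate (hγ : 1 < γ) (hz : ∃ p : ℤ, z ≤ γ ^ p) (h1 : 1 ≤ z) :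
    1 ≤ growthRate γ z := by
  refine le_growthRate hz fun n p hn h => ?_
  have hp : 0 ≤ p := by
    have := (one_le_pow_of_one_le' h1 n).trans h
    rwa [one_le_zpow_iff_right₀ hγ] at this
  rw [Real.one_le_exp_iff]
  positivity

lemma growthRate_one (hγ : 1 < γ) : growthRate γ (1 : Γ) = 1 := by
  apply le_antisymm
  · simpa using growthRate_le (γ := γ) (z := 1) (n := 1) (p := 0) one_pos (by simp)
  · exact one_le_growthRate hγ ⟨0, by simp⟩ le_rfl

lemma one_lt_growthRate_self (hγ : 1 < γ) : 1 < growthRate γ γ := by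
  refine (Real.one_lt_exp_iff.2 one_pos).trans_le (le_growthRate ⟨1, by simp⟩ fun n p hn h => ?_)
  rw [← zpow_natCast, zpow_le_zpow_iff_right₀ hγ] at h
  have : (n : ℝ) ≤ p := by exact_mod_cast h
  rw [Real.exp_le_exp, one_le_div (by positivity)]
  exact this

lemma growthRate_zero (γ : Γ) : growthRate γ 0 = 0 := by
  refine le_antisymm (le_of_forall_pos_le_add fun ε hε => ?_) (growthRate_nonneg _ _)
  obtain ⟨n, hn⟩ := exists_nat_gt (-Real.log ε)
  refine (growthRate_le (n := 1) (p := -n) one_pos (by simp)).trans ?_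
  rw [zero_add]
  calc Real.exp (((-n : ℤ) : ℝ) / (1 : ℕ)) ≤ Real.exp (Real.log ε) := by
        rw [Real.exp_le_exp]
        push_cast
        linarith
    _ = ε := Real.exp_log hε

lemma growthRate_mul_inv_le (hγ : 1 < γ) (hz0 : z ≠ 0)
    (hz : ∃ p : ℤ, z ≤ γ ^ p) (hz' : ∃ p : ℤ, z⁻¹ ≤ γ ^ p) :
    growthRate γ z * growthRate γ z⁻¹ ≤ 1 := by
  have hγ0 : γ ≠ 0 := (zero_lt_one.trans hγ).ne'
  have key : ∀ n : ℕ, 0 < n → growthRate γ z * growthRate γ z⁻¹ ≤ Real.exp (1 / n) := by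
    intro n hn
    obtain ⟨a, ha⟩ := hz
    obtain ⟨b, hb⟩ := hz'
    have hex : ∃ p : ℤ, z ^ n ≤ γ ^ p :=
      ⟨a * n, by rw [zpow_mul, zpow_natCast]; exact pow_le_pow_left₀ zero_le ha _⟩
    have hbd : ∀ p : ℤ, z ^ n ≤ γ ^ p → -(b * n) ≤ p := by
      intro p hp
      have h1 : (z ^ n)⁻¹ ≤ γ ^ (b * n) := by
        rw [← inv_pow, zpow_mul, zpow_natCast]
        exact pow_le_pow_left₀ zero_le hb _
      have h2 : (1 : Γ) ≤ γ ^ (p + b * n) := by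
        rw [zpow_add₀ hγ0, ← mul_inv_cancel₀ (pow_ne_zero n hz0)]
        exact mul_le_mul' hp h1
      rw [one_le_zpow_iff_right₀ hγ] at h2
      linarith
    obtain ⟨p, hp, hmin⟩ := Int.exists_least_of_bdd ⟨_, hbd⟩ hex
    have h' : (z⁻¹) ^ n ≤ γ ^ (1 - p) := by
      have : ¬ z ^ n ≤ γ ^ (p - 1) := fun h => by linarith [hmin _ h]
      rw [not_le] at this
      rw [inv_pow, show (1 : ℤ) - p = -(p - 1) by ring, zpow_neg]
      exact inv_anti₀ (zpow_pos (zero_lt_one.trans hγ) _) this.le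
    calc growthRate γ z * growthRate γ z⁻¹
        ≤ Real.exp (p / n) * Real.exp (((1 - p : ℤ) : ℝ) / n) :=
          mul_le_mul (growthRate_le hn hp) (growthRate_le hn h') (growthRate_nonneg _ _)
            (Real.exp_pos _).le
      _ = Real.exp (1 / n) := by
          rw [← Real.exp_add]
          congr 1
          push_cast
          ring
  have hlim : Filter.Tendsto (fun n : ℕ => Real.exp (1 / (n : ℝ))) Filter.atTop (nhds 1) := by
    simpa [Function.comp_def] using
      (Real.continuous_exp.tendsto 0).comp tendsto_one_div_atTop_nhds_zero_nat
  exact ge_of_tendsto hlim (Filter.eventually_gt_atTop 0 |>.mono key)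

lemma growthRate_mul_inv (hγ : 1 < γ) (hz0 : z ≠ 0)
    (hz : ∃ p : ℤ, z ≤ γ ^ p) (hz' : ∃ p : ℤ, z⁻¹ ≤ γ ^ p) :
    growthRate γ z * growthRate γ z⁻¹ = 1 := by
  refine (growthRate_mul_inv_le hγ hz0 hz hz').antisymm ?_
  have := growthRate_mul_le (zero_lt_one.trans hγ).ne' hz hz'
  rwa [mul_inv_cancel₀ hz0, growthRate_one hγ] at this

lemma growthRate_mul (hγ : 1 < γ) (hy0 : y ≠ 0) (hy : ∃ p : ℤ, y ≤ γ ^ p)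
    (hy' : ∃ p : ℤ, y⁻¹ ≤ γ ^ p) (hz : ∃ p : ℤ, z ≤ γ ^ p) :
    growthRate γ (y * z) = growthRate γ y * growthRate γ z := by
  have hγ0 : γ ≠ 0 := (zero_lt_one.trans hγ).ne'
  have hinv := growthRate_mul_inv hγ hy0 hy hy'
  refine (growthRate_mul_le hγ0 hy hz).antisymm ?_
  have hyz : ∃ p : ℤ, y * z ≤ γ ^ p := by
    obtain ⟨p, hp⟩ := hy
    obtain ⟨q, hq⟩ := hz
    exact ⟨p + q, by rw [zpow_add₀ hγ0]; exact mul_le_mul' hp hq⟩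
  have h := growthRate_mul_le hγ0 hy' hyz
  rw [inv_mul_cancel_left₀ hy0] at h
  calc growthRate γ y * growthRate γ z
      ≤ growthRate γ y * (growthRate γ y⁻¹ * growthRate γ (y * z)) :=
        mul_le_mul_of_nonneg_left h (growthRate_nonneg _ _)
    _ = growthRate γ (y * z) := by rw [← mul_assoc, hinv, one_mul]

end growthRate

/-- `q` is a cocycle for the action of `G` on `F` by multiplication through `L`. -/
structure IsAffineCocycle {G F : Type*} [Group G] [Field F] (L : G →* Fˣ) (q : G → F) : Prop where
  map_mul : ∀ x y, q (x * y) = q x + (L x : F) * q y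

/-- `L` admits a size function: a nontrivial character `α` for which every nonzero affine cocycle
`q` over `L` has a nonzero subadditive size `Q`. -/
def HasCocycleSize {G F : Type*} [Group G] [Field F] (L : G →* Fˣ) : Prop :=
  ∃ (α : G → ℝ) (t : G), (∀ x, 0 < α x) ∧ (∀ x y, α (x * y) = α x * α y) ∧ α t ≠ 1 ∧ L t ≠ 1 ∧
    ∀ q : G → F, IsAffineCocycle L q → (∃ x, q x ≠ 0) →
      ∃ Q : G → ℝ, (∀ x, 0 ≤ Q x) ∧ (∀ x y, Q (x * y) ≤ Q x + α x * Q y) ∧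
        (∀ x, α x * Q x⁻¹ = Q x) ∧ (∀ x, q x = 0 → Q x = 0) ∧ ∃ x, Q x ≠ 0

section

variable {G F : Type*} [Group G] [Field F] {L : G →* Fˣ} {q : G → F}

lemma IsAffineCocycle.map_one (hq : IsAffineCocycle L q) : q 1 = 0 := by
  simpa using hq.map_mul 1 1

lemma IsAffineCocycle.mul_map_inv (hq : IsAffineCocycle L q) (x : G) :
    (L x : F) * q x⁻¹ = -q x := by
  have := hq.map_mul x x⁻¹
  rw [mul_inv_cancel, hq.map_one] at this
  linear_combination -this

lemma closure_induction_of_symm {S : Finset G} (hSgen : Subgroup.closure (S : Set G) = ⊤)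
    (hSsym : ∀ s ∈ S, s⁻¹ ∈ S) {P : G → Prop} (one : P 1)
    (mul : ∀ s ∈ S, ∀ x, P x → P (s * x)) (x : G) : P x := by
  have hx : x ∈ Subgroup.closure (S : Set G) := hSgen ▸ Subgroup.mem_top x
  refine Subgroup.closure_induction_left (p := fun x _ => P x) one
    (fun s hs x _ h => mul s hs x h) (fun s hs x _ h => mul _ (hSsym s hs) x h) hx

lemma hasCocycleSize_of_valuation {Γ : Type*} [LinearOrderedCommGroupWithZero Γ]
    {S : Finset G} (hSgen : Subgroup.closure (S : Set G) = ⊤) (hSsym : ∀ s ∈ S, s⁻¹ ∈ S)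
    (v : Valuation F Γ) {x₀ : G} (hx₀ : 1 < v (L x₀)) : HasCocycleSize L := by
  have hSne : S.Nonempty := by
    by_contra h
    rw [Finset.not_nonempty_iff_eq_empty] at h
    have : x₀ = 1 := closure_induction_of_symm (P := (· = 1)) hSgen hSsym rfl (by simp [h]) x₀
    simp [this] at hx₀
  obtain ⟨t, htS, ht⟩ := S.exists_max_image (fun s => v (L s)) hSne
  set γ := v (L t) with hγdef
  have hγ : 1 < γ := by
    by_contra! hle
    refine hx₀.not_ge (closure_induction_of_symm (P := fun x => v (L x) ≤ 1) hSgen hSsym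
      (by simp) (fun s hs x hx => ?_) x₀)
    simpa using mul_le_one' ((ht s hs).trans hle) hx
  have hγ0 : γ ≠ 0 := (zero_lt_one.trans hγ).ne'
  have hL0 : ∀ x, v (L x) ≠ 0 := fun x => by simp
  have hLb : ∀ x, ∃ p : ℤ, v (L x) ≤ γ ^ p := by
    refine closure_induction_of_symm hSgen hSsym ⟨0, by simp⟩ fun s hs x ⟨p, hp⟩ => ?_
    refine ⟨1 + p, ?_⟩
    rw [zpow_add₀ hγ0, zpow_one]
    simpa using mul_le_mul' (ht s hs) hp
  have hLi : ∀ x, v (L x⁻¹) = (v (L x))⁻¹ := fun x => by simp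
  have hLb' : ∀ x, ∃ p : ℤ, (v (L x))⁻¹ ≤ γ ^ p := fun x => by simpa [hLi] using hLb x⁻¹
  refine ⟨fun x => growthRate γ (v (L x)), t, fun x => ?_, fun x y => ?_, ?_, ?_, ?_⟩
  · refine (growthRate_nonneg _ _).lt_of_ne fun h => ?_
    have := growthRate_mul_inv hγ (hL0 x) (hLb x) (hLb' x)
    simp [← h] at this
  · simpa using growthRate_mul hγ (hL0 x) (hLb x) (hLb' x) (hLb y)
  · exact (one_lt_growthRate_self hγ).ne'
  · intro h
    simp [hγdef, h] at hγ
  intro q hq ⟨x₁, hx₁⟩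
  obtain ⟨s, hsS, hs⟩ := S.exists_max_image (fun s => v (q s)) hSne
  have hqs : q s ≠ 0 := by
    intro h0
    refine hx₁ (closure_induction_of_symm (P := fun x => q x = 0) hSgen hSsym hq.map_one
      (fun r hr x hx => ?_) x₁)
    have : q r = 0 := by simpa [h0] using hs r hr
    rw [hq.map_mul, this, hx]
    simp
  have hvs : v (q s) ≠ 0 := by simpa using hqs
  have hQb : ∀ x, ∃ p : ℤ, v (q x / q s) ≤ γ ^ p := by
    intro x
    suffices ∃ p : ℤ, 0 ≤ p ∧ v (q x / q s) ≤ γ ^ p from this.imp fun _ h => h.2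
    refine closure_induction_of_symm
      (P := fun x => ∃ p : ℤ, 0 ≤ p ∧ v (q x / q s) ≤ γ ^ p) hSgen hSsym
      ⟨0, le_rfl, by simp [hq.map_one]⟩ (fun r hr x ⟨p, hp0, hp⟩ => ⟨1 + p, by positivity, ?_⟩) x
    have h1 : (1 : Γ) ≤ γ ^ (1 + p) := by
      rw [one_le_zpow_iff_right₀ hγ]
      positivity
    rw [hq.map_mul, add_div]
    refine v.map_add_le ?_ ?_
    · refine le_trans ?_ h1
      rw [map_div₀]
      exact (div_le_one₀ (zero_lt_iff.2 hvs)).2 (hs r hr)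
    · rw [mul_div_assoc, map_mul, zpow_add₀ hγ0, zpow_one]
      exact mul_le_mul' (ht r hr) hp
  refine ⟨fun x => growthRate γ (v (q x / q s)), fun x => growthRate_nonneg _ _, fun x y => ?_,
    fun x => ?_, fun x hx => ?_, s, ?_⟩
  · beta_reduce
    rw [← growthRate_mul hγ (hL0 x) (hLb x) (hLb' x) (hQb y), hq.map_mul, add_div, mul_div_assoc]
    have hxy : ∃ p : ℤ, v (L x) * v (q y / q s) ≤ γ ^ p := by
      obtain ⟨a, ha⟩ := hLb x
      obtain ⟨b, hb⟩ := hQb y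
      exact ⟨a + b, by rw [zpow_add₀ hγ0]; exact mul_le_mul' ha hb⟩
    rcases le_total (v (q x / q s)) (v (L x) * v (q y / q s)) with h | h
    · refine (growthRate_mono hxy (v.map_add_le h (by simp))).trans ?_
      exact le_add_of_nonneg_left (growthRate_nonneg _ _)
    · refine (growthRate_mono (hQb x) (v.map_add_le le_rfl (by simpa using h))).trans ?_
      exact le_add_of_nonneg_right (growthRate_nonneg _ _)
  · rw [← growthRate_mul hγ (hL0 x) (hLb x) (hLb' x) (hQb x⁻¹), ← map_mul, ← mul_div_assoc,
      hq.mul_map_inv, neg_div, Valuation.map_neg]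
  · simp [hx, growthRate_zero]
  · simp [hqs, growthRate_one hγ]

lemma hasCocycleSize_of_not_isIntegral
    {S : Finset G} (hSgen : Subgroup.closure (S : Set G) = ⊤) (hSsym : ∀ s ∈ S, s⁻¹ ∈ S)
    {x₀ : G} (hx₀ : ¬ IsIntegral ℤ (L x₀ : F)) : HasCocycleSize L := by
  have hmem : (L x₀ : F) ∉ (integralClosure ℤ F).toSubring := hx₀
  have : IsIntegrallyClosedIn (integralClosure ℤ F).toSubring F :=
    inferInstanceAs (IsIntegrallyClosedIn (integralClosure ℤ F) F)
  obtain ⟨V, -, hV⟩ := Subring.exists_le_valuationSubring_of_isIntegrallyClosedIn hmem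
  refine hasCocycleSize_of_valuation hSgen hSsym V.valuation (x₀ := x₀) ?_
  rwa [← not_le, V.valuation_le_one_iff]

lemma finite_range_of_isIntegral_of_charP (p : ℕ) [CharP F p] (hp : p ≠ 0)
    {S : Finset G} (hSgen : Subgroup.closure (S : Set G) = ⊤) (hSsym : ∀ s ∈ S, s⁻¹ ∈ S)
    (hL : ∀ x, IsIntegral ℤ (L x : F)) : Finite L.range := by
  set A := Algebra.adjoin ℤ ((fun s => (L s : F)) '' (S : Set G))
  have hfg : (Subalgebra.toSubmodule A).FG :=
    fg_adjoin_of_finite (S.finite_toSet.image _) (by rintro _ ⟨s, -, rfl⟩; exact hL s)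
  have : Module.Finite ℤ A := Module.Finite.iff_fg.2 hfg
  have : Finite A := Module.finite_of_fg_torsion A fun {a} =>
    ⟨⟨(p : ℤ), mem_nonZeroDivisors_of_ne_zero (by exact_mod_cast hp)⟩, by
      ext
      simp [Submonoid.smul_def]⟩
  have hmem : ∀ x, (L x : F) ∈ A := by
    refine closure_induction_of_symm hSgen hSsym (by simp [A.one_mem]) fun s hs x hx => ?_
    simpa using A.mul_mem (Algebra.subset_adjoin ⟨s, hs, rfl⟩) hx
  refine Finite.of_injective (β := A) (fun u => ⟨(u : Fˣ), ?_⟩) fun u w h => ?_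
  · obtain ⟨_, x, rfl⟩ := u
    exact hmem x
  · exact Subtype.ext (Units.ext (congrArg Subtype.val h))

lemma hasCocycleSize_of_isIntegral_of_charZero [CharZero F]
    {S : Finset G} (hSgen : Subgroup.closure (S : Set G) = ⊤) (hSsym : ∀ s ∈ S, s⁻¹ ∈ S)
    (hL : ∀ x, IsIntegral ℤ (L x : F)) (hinf : Infinite L.range) : HasCocycleSize L := by
  set k := IntermediateField.adjoin ℚ ((fun s => (L s : F)) '' (S : Set G))
  have : Finite ((fun s => (L s : F)) '' (S : Set G)) := (S.finite_toSet.image _).to_subtype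
  have : FiniteDimensional ℚ k := IntermediateField.finiteDimensional_adjoin
    (by rintro _ ⟨s, -, rfl⟩; exact (hL s).tower_top)
  have : NumberField k := ⟨⟩
  have hmem : ∀ x, (L x : F) ∈ k := by
    refine closure_induction_of_symm hSgen hSsym (by simp [k.one_mem]) fun s hs x hx => ?_
    simpa using k.mul_mem (IntermediateField.subset_adjoin _ _ ⟨s, hs, rfl⟩) hx
  let l : G →* k :=
    { toFun := fun x => ⟨L x, hmem x⟩
      map_one' := by ext; simp
      map_mul' := fun x y => by ext; simp }
  have hl0 : ∀ x, l x ≠ 0 := fun x h => (L x).ne_zero (congrArg Subtype.val h)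
  obtain ⟨t, φ, hφ⟩ : ∃ t, ∃ φ : k →+* ℂ, 1 < ‖φ (l t)‖ := by
    by_contra! h
    have hfin := NumberField.Embeddings.finite_of_norm_le k ℂ 1
    refine hinf.not_finite ?_
    have := hfin.to_subtype
    refine Finite.of_injective
      (β := {x : k | IsIntegral ℤ x ∧ ∀ φ : k →+* ℂ, ‖φ x‖ ≤ 1})
      (fun u => ⟨⟨(u : Fˣ), ?_⟩, ?_⟩) fun u w h => ?_
    · obtain ⟨_, x, rfl⟩ := u
      exact hmem x
    · obtain ⟨_, x, rfl⟩ := u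
      refine ⟨?_, h x⟩
      have hi : IsIntegral ℤ (algebraMap k F (l x)) := hL x
      exact (isIntegral_algebraMap_iff (algebraMap k F).injective).1 hi
    · exact Subtype.ext (Units.ext (congrArg (fun z => ((z.1 : k) : F)) h))
  refine ⟨fun x => ‖φ (l x)‖, t, fun x => ?_, fun x y => by simp, hφ.ne', ?_, ?_⟩
  · simpa using hl0 x
  · intro h
    have : l t = 1 := Subtype.ext (by simp [l, h])
    simp [this] at hφ
  intro q hq ⟨x₁, hx₁⟩
  obtain ⟨π, hπ⟩ : ∃ π : Module.Dual k F, π (q x₁) ≠ 0 := by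
    by_contra! h
    exact hx₁ ((Module.forall_dual_apply_eq_zero_iff k _).1 h)
  have hπL : ∀ x z, π ((L x : F) * z) = l x * π z := fun x z => π.map_smul (l x) z
  refine ⟨fun x => ‖φ (π (q x))‖, fun x => norm_nonneg _, fun x y => ?_, fun x => ?_,
    fun x hx => by simp [hx], x₁, by simpa using hπ⟩
  · beta_reduce
    rw [hq.map_mul, map_add, hπL, map_add, map_mul, ← norm_mul]
    exact norm_add_le _ _
  · rw [← norm_mul, ← map_mul, ← hπL, hq.mul_map_inv]
    simp

lemma hasCocycleSize_of_infinite_range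
    {S : Finset G} (hSgen : Subgroup.closure (S : Set G) = ⊤) (hSsym : ∀ s ∈ S, s⁻¹ ∈ S)
    (hinf : Infinite L.range) : HasCocycleSize L := by
  by_cases hL : ∀ x, IsIntegral ℤ (L x : F)
  · obtain ⟨p, hp⟩ := CharP.exists F
    rcases eq_or_ne p 0 with rfl | hp0
    · have := CharP.charP_to_charZero F
      exact hasCocycleSize_of_isIntegral_of_charZero hSgen hSsym hL hinf
    · exact (hinf.not_finite (finite_range_of_isIntegral_of_charP p hp0 hSgen hSsym hL)).elim
  · push Not at hL
    obtain ⟨x₀, hx₀⟩ := hL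
    exact hasCocycleSize_of_not_isIntegral hSgen hSsym hx₀

end

namespace Aff

/-- The linear part as a group homomorphism. -/
def lHom (F : Type*) [Field F] : Aff F →* Fˣ where
  toFun := l
  map_one' := one_l
  map_mul' := mul_l

lemma exists_size {F : Type*} [Field F] (G : Subgroup (Aff F))
    (S : Finset ↥G) (hSgen : Subgroup.closure (S : Set ↥G) = ⊤)
    (hSsym : ∀ s ∈ S, s⁻¹ ∈ S)
    (hnotva : ¬ ∃ H : Subgroup ↥G, H.FiniteIndex ∧ ∀ a ∈ H, ∀ b ∈ H, a * b = b * a) :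
    ∃ (α Q : ↥G → ℝ) (t s : ↥G), (∀ x, 0 < α x) ∧ (∀ x y, α (x * y) = α x * α y) ∧
      (∀ x, 0 ≤ Q x) ∧ (∀ x y, Q (x * y) ≤ Q x + α x * Q y) ∧ (∀ x, α x * Q x⁻¹ = Q x) ∧
      α t ≠ 1 ∧ Q t = 0 ∧ Q s ≠ 0 := by
  set L : ↥G →* Fˣ := (lHom F).comp G.subtype
  have hLdef : ∀ x : ↥G, L x = (x : Aff F).l := fun _ => rfl
  have hinf : Infinite L.range := by
    rw [← not_finite_iff_infinite]
    intro hfin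
    refine hnotva ⟨L.ker, Subgroup.finiteIndex_ker L, fun a ha b hb => ?_⟩
    rw [MonoidHom.mem_ker, hLdef] at ha hb
    refine Subtype.ext (Aff.ext ?_ ?_)
    · simp [ha, hb, add_comm]
    · simp [ha, hb]
  obtain ⟨α, t, hα, hαm, hαt, hLt, H⟩ := hasCocycleSize_of_infinite_range hSgen hSsym hinf
  have hd : 1 - (L t : F) ≠ 0 := fun h => hLt (Units.ext (by simpa using (sub_eq_zero.1 h).symm))
  set p : F := (t : Aff F).c / (1 - (L t : F))
  let q : ↥G → F := fun x => (x : Aff F).c + (L x : F) * p - p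
  have hq : IsAffineCocycle L q := ⟨fun x y => by
    simp only [q, Subgroup.coe_mul, mul_c, mul_l, Units.val_mul, hLdef]
    ring⟩
  have hqt : q t = 0 := by
    simp only [q, p]
    field_simp
    ring
  have hne : ∃ x, q x ≠ 0 := by
    by_contra! h
    refine hnotva ⟨⊤, inferInstance, fun a _ b _ => Subtype.ext (Aff.ext ?_ ?_)⟩
    · have ha := h a
      have hb := h b
      simp only [q, hLdef] at ha hb
      simp only [Subgroup.coe_mul, mul_c]
      linear_combination (1 - ((b : Aff F).l : F)) * ha - (1 - ((a : Aff F).l : F)) * hb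
    · simp [mul_comm]
  obtain ⟨Q, hQ0, hQ, hQi, hQz, s, hs⟩ := H q hq hne
  exact ⟨α, Q, t, s, hα, hαm, hQ0, hQ, hQi, hαt, hQz t hqt, hs⟩

end Aff

theorem exists_positive_linear_growth_harmonic_on_affine_subgroup
    {F : Type*} [Field F] (G : Subgroup (Aff F))
    (S : Finset ↥G) (hSgen : Subgroup.closure (S : Set ↥G) = ⊤)
    (hSsym : ∀ s ∈ S, s⁻¹ ∈ S)
    -- G is not virtually abelian
    (hnotva : ¬ ∃ H : Subgroup ↥G, H.FiniteIndex ∧ ∀ a ∈ H, ∀ b ∈ H, a * b = b * a)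
    -- μ is a courteous measure on G
    (μ : ↥G → ℝ) (hnonneg : ∀ x, 0 ≤ μ x) (hprob : HasSum μ 1)
    (hsym : ∀ x : ↥G, μ x⁻¹ = μ x)
    (hadapted : Subgroup.closure {x : ↥G | μ x ≠ 0} = ⊤)
    (hsmooth : ∃ ζ : ℝ, 0 < ζ ∧
      Summable (fun x : ↥G => μ x * Real.exp (ζ * (wordLen (S : Set ↥G) x)))) :
    ∃ f : ↥G → ℝ,
      -- f is nonnegative
      (∀ x, 0 ≤ f x) ∧
      -- f is μ-harmonic
      (∀ x : ↥G, f x = ∑' s : ↥G, μ s * f (x * s⁻¹)) ∧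
      -- f is non-constant
      (¬ ∃ c : ℝ, ∀ x, f x = c) ∧
      -- f has linear growth: ‖f‖₁ < ∞
      polyNormR (S : Set ↥G) 1 f < ⊤ ∧
      -- the span of the G-orbit of f is infinite dimensional
      (¬ ∃ W : Submodule ℝ (↥G → ℝ), FiniteDimensional ℝ W ∧
        ∀ x : ↥G, (fun y : ↥G => f (x⁻¹ * y)) ∈ W) := by
  obtain ⟨α, Q, t, s, hα, hαm, hQ0, hQ, hQi, ht1, ht, hs⟩ := Aff.exists_size G S hSgen hSsym hnotva
  obtain ⟨f, hf0, hfh, hfg, hfd⟩ := exists_harmonic_of_similarityLength hSgen hSsym hnonneg hprob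
    hsym hadapted hsmooth hα hαm hQ0 hQ hQi ht1 ht hs
  refine ⟨f, hf0, hfh, ?_, hfg, hfd⟩
  rintro ⟨c, hc⟩
  refine hfd ⟨Submodule.span ℝ {fun _ => c},
    FiniteDimensional.span_of_finite ℝ (Set.finite_singleton _), fun x => ?_⟩
  simp only [hc]
  exact Submodule.mem_span_singleton_self _
end

section
/- Let G be a countable group and μ a symmetric adapted probability measure on G. If V is a non-trivial (nonzero) finite-dimensional G-invariant subspace of the space BHF(G,μ) of bounded μ-harmonic functions on G, then V is exactly the space of constant functions. In particular, if dim BHF(G,μ) < ∞ then every bounded μ-harmonic function on G is constant. -/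
/-- `f : G → ℂ` is `μ`-harmonic: `f x = ∑ₛ μ(s) f(x s⁻¹)`. -/
def IsHarmonic {G : Type*} [Group G] (μ : G → ℝ) (f : G → ℂ) : Prop :=
  ∀ x : G, f x = ∑' s : G, (μ s : ℂ) * f (x * s⁻¹)

/-- The set of bounded `μ`-harmonic functions on `G`. -/
def BHF {G : Type*} [Group G] (μ : G → ℝ) : Set (G → ℂ) :=
  {f | IsHarmonic μ f ∧ ∃ C : ℝ, ∀ x : G, ‖f x‖ ≤ C}

open scoped BoundedContinuousFunction

section HarmonicFunctions

variable {G : Type*} [Group G] {μ : G → ℝ}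

theorem summable_mul_of_bounded (hnonneg : ∀ x, 0 ≤ μ x) (hprob : HasSum μ 1) {f : G → ℂ}
    (hf : ∃ C : ℝ, ∀ x, ‖f x‖ ≤ C) (x : G) : Summable fun s => (μ s : ℂ) * f (x * s⁻¹) := by
  obtain ⟨C, hC⟩ := hf
  refine Summable.of_norm_bounded (hprob.summable.mul_right C) fun s => ?_
  rw [norm_mul, Complex.norm_real, Real.norm_of_nonneg (hnonneg s)]
  exact mul_le_mul_of_nonneg_left (hC _) (hnonneg s)

/-- A complex number in the disc of radius `‖a‖` with maximal real part in the direction of `a`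
is equal to `a`. -/
theorem Complex.eq_of_norm_le_of_re_conj_mul {a b : ℂ} (hb : ‖b‖ ≤ ‖a‖)
    (h : (starRingEnd ℂ a * b).re = (starRingEnd ℂ a * a).re) : b = a := by
  have hb' := (sq_le_sq₀ (norm_nonneg b) (norm_nonneg a)).2 hb
  rw [Complex.sq_norm, Complex.sq_norm, Complex.normSq_apply, Complex.normSq_apply] at hb'
  simp only [Complex.mul_re, Complex.conj_re, Complex.conj_im] at h
  apply Complex.ext <;>
    nlinarith [sq_nonneg (b.re - a.re), sq_nonneg (b.im - a.im)]

/-- The local maximum principle: if `‖f‖` is maximal at `x`, then `f` agrees with `f x` at the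
neighbours of `x`. -/
theorem IsHarmonic.eq_of_norm_le (hnonneg : ∀ x, 0 ≤ μ x) (hprob : HasSum μ 1) {f : G → ℂ}
    (hf : IsHarmonic μ f) {x : G} (hmax : ∀ y, ‖f y‖ ≤ ‖f x‖) {s : G} (hs : μ s ≠ 0) :
    f (x * s⁻¹) = f x := by
  set a := f x with ha
  have hsum : HasSum (fun s => (μ s : ℂ) * f (x * s⁻¹)) a := by
    rw [ha, hf x]
    exact (summable_mul_of_bounded hnonneg hprob ⟨_, hmax⟩ x).hasSum
  have hre := Complex.hasSum_re (hsum.mul_left (starRingEnd ℂ a))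
  have hdiff := (hprob.mul_right (starRingEnd ℂ a * a).re).sub hre
  rw [one_mul, sub_self] at hdiff
  have hterm : ∀ t, μ t * (starRingEnd ℂ a * a).re
        - (starRingEnd ℂ a * ((μ t : ℂ) * f (x * t⁻¹))).re
      = μ t * ((starRingEnd ℂ a * a).re - (starRingEnd ℂ a * f (x * t⁻¹)).re) := fun t => by
    rw [mul_left_comm, Complex.re_ofReal_mul, mul_sub]
  simp only [hterm] at hdiff
  have hle : ∀ t, (starRingEnd ℂ a * f (x * t⁻¹)).re ≤ (starRingEnd ℂ a * a).re := fun t => by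
    calc (starRingEnd ℂ a * f (x * t⁻¹)).re ≤ ‖starRingEnd ℂ a * f (x * t⁻¹)‖ :=
          Complex.re_le_norm _
      _ ≤ ‖a‖ * ‖a‖ := by
          rw [norm_mul, Complex.norm_conj]
          exact mul_le_mul_of_nonneg_left (hmax _) (norm_nonneg _)
      _ = (starRingEnd ℂ a * a).re := by
          rw [mul_comm (starRingEnd ℂ a), Complex.mul_conj, Complex.ofReal_re, Complex.normSq_eq_norm_sq, sq]
  have hzero := (hasSum_zero_iff_of_nonneg fun t =>
    mul_nonneg (hnonneg t) (sub_nonneg.2 (hle t))).1 hdiff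
  have hs' := (mul_eq_zero.1 (congrFun hzero s)).resolve_left hs
  exact Complex.eq_of_norm_le_of_re_conj_mul (hmax _) (sub_eq_zero.1 hs').symm

/-- The maximum principle: a harmonic function whose norm attains its maximum is constant. -/
theorem IsHarmonic.eq_const_of_norm_le (hnonneg : ∀ x, 0 ≤ μ x) (hprob : HasSum μ 1)
    (hsym : ∀ x : G, μ x⁻¹ = μ x) (hadapted : Subgroup.closure {x : G | μ x ≠ 0} = ⊤)
    {f : G → ℂ} (hf : IsHarmonic μ f) (hmax : ∀ y, ‖f y‖ ≤ ‖f 1‖) (y : G) : f y = f 1 := by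
  have hstep : ∀ (x s : G), μ s ≠ 0 → f x = f 1 → f (x * s⁻¹) = f 1 := fun x s hs hx =>
    (hf.eq_of_norm_le hnonneg hprob (x := x) (by rwa [hx]) hs).trans hx
  have hy : y ∈ Subgroup.closure {x : G | μ x ≠ 0} := hadapted ▸ Subgroup.mem_top y
  induction hy using Subgroup.closure_induction_right with
  | one => rfl
  | mul_right x _ s hs ih => simpa using hstep x s⁻¹ (by rwa [hsym]) ih
  | mul_inv_cancel x _ s hs ih => exact hstep x s hs ih

/-- Functions in a finite-dimensional translation-invariant space of bounded harmonic functions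
are constant. -/
theorem eq_const_of_mem_finiteDimensional (hnonneg : ∀ x, 0 ≤ μ x) (hprob : HasSum μ 1)
    (hsym : ∀ x : G, μ x⁻¹ = μ x) (hadapted : Subgroup.closure {x : G | μ x ≠ 0} = ⊤)
    (V : Submodule ℂ (G → ℂ)) (hV : (V : Set (G → ℂ)) ⊆ BHF μ)
    (hinv : ∀ (x : G), ∀ f ∈ V, (fun y : G => f (x⁻¹ * y)) ∈ V) [FiniteDimensional ℂ V]
    {f : G → ℂ} (hf : f ∈ V) : ∃ c : ℂ, f = fun _ => c := by
  let : TopologicalSpace G := ⊥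
  have : DiscreteTopology G := ⟨rfl⟩
  let coeHom : (G →ᵇ ℂ) →ₗ[ℂ] (G → ℂ) :=
    { toFun := fun g => g, map_add' := fun _ _ => rfl, map_smul' := fun _ _ => rfl }
  let U : Submodule ℂ (G →ᵇ ℂ) := V.comap coeHom
  let ι : U →ₗ[ℂ] V := coeHom.restrict fun _ h => h
  have hι : Function.Injective ι := fun g h hgh =>
    Subtype.ext (DFunLike.coe_injective (congrArg Subtype.val hgh))
  have : FiniteDimensional ℂ U := FiniteDimensional.of_injective ι hι
  have : ProperSpace U := FiniteDimensional.proper ℂ U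
  obtain ⟨C, hC⟩ := (hV hf).2
  let translate (x : G) : U :=
    ⟨BoundedContinuousFunction.ofNormedAddCommGroupDiscrete (fun y => f (x⁻¹ * y)) C
      fun _ => hC _, hinv x f hf⟩
  have translate_apply (x y : G) : (translate x).1 y = f (x⁻¹ * y) := rfl
  have hC0 : 0 ≤ C := (norm_nonneg _).trans (hC 1)
  have hcompact : IsCompact (closure (Set.range translate)) := by
    refine Bornology.IsBounded.isCompact_closure (isBounded_iff_forall_norm_le.2 ⟨C, ?_⟩)
    rintro _ ⟨x, rfl⟩
    exact (BoundedContinuousFunction.norm_le hC0).2 fun y => hC _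
  have hcont (y : G) : Continuous fun g : U => g.1 y :=
    (BoundedContinuousFunction.lipschitz_eval_const y).continuous.comp continuous_subtype_val
  obtain ⟨g, hg, hgmax⟩ := hcompact.exists_isMaxOn
    ((Set.range_nonempty translate).closure) (hcont 1).norm.continuousOn
  have hfg (y : G) : ‖f y‖ ≤ ‖g.1 1‖ := by
    simpa [translate_apply] using hgmax (subset_closure ⟨y⁻¹, rfl⟩)
  have hgg (y : G) : ‖g.1 y‖ ≤ ‖g.1 1‖ := by
    refine closure_minimal (t := {h : U | ‖h.1 y‖ ≤ ‖g.1 1‖}) ?_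
      (isClosed_le (hcont y).norm continuous_const) hg
    rintro _ ⟨x, rfl⟩
    exact hfg _
  have hconst (y : G) : g.1 y = g.1 1 :=
    (hV g.2).1.eq_const_of_norm_le hnonneg hprob hsym hadapted hgg y
  refine ⟨g.1 1, funext fun y => ?_⟩
  rw [← sub_eq_zero, ← norm_le_zero_iff]
  refine le_of_forall_pos_le_add fun ε hε => ?_
  obtain ⟨_, ⟨x, rfl⟩, hx⟩ := Metric.mem_closure_iff.1 hg ε hε
  have hxy := (BoundedContinuousFunction.dist_coe_le_dist (f := g.1) (g := (translate x).1)
    (x * y)).trans hx.le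
  rwa [translate_apply, inv_mul_cancel_left, hconst, dist_comm, dist_eq_norm,
    ← zero_add ε] at hxy

/-- The bounded harmonic functions as a subspace of all functions. -/
def boundedHarmonicSubmodule (hnonneg : ∀ x, 0 ≤ μ x) (hprob : HasSum μ 1) :
    Submodule ℂ (G → ℂ) where
  carrier := BHF μ
  zero_mem' := ⟨fun x => by simp, 0, fun x => by simp⟩
  add_mem' := by
    rintro f g ⟨hf, hfb⟩ ⟨hg, hgb⟩
    refine ⟨fun x => ?_, ?_⟩
    · simp only [Pi.add_apply, mul_add]
      rw [(summable_mul_of_bounded hnonneg hprob hfb x).tsum_add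
        (summable_mul_of_bounded hnonneg hprob hgb x), ← hf x, ← hg x]
    · obtain ⟨C, hC⟩ := hfb
      obtain ⟨D, hD⟩ := hgb
      exact ⟨C + D, fun x => norm_add_le_of_le (hC x) (hD x)⟩
  smul_mem' := by
    rintro c f ⟨hf, C, hC⟩
    refine ⟨fun x => ?_, ‖c‖ * C, fun x => ?_⟩
    · simp only [Pi.smul_apply, smul_eq_mul, mul_left_comm _ c]
      rw [tsum_mul_left, ← hf x]
    · rw [Pi.smul_apply, norm_smul]
      exact mul_le_mul_of_nonneg_left (hC x) (norm_nonneg c)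

theorem BHF_translate {f : G → ℂ} (hf : f ∈ BHF μ) (x : G) :
    (fun y : G => f (x⁻¹ * y)) ∈ BHF μ := by
  obtain ⟨hf, C, hC⟩ := hf
  exact ⟨fun y => by simpa only [mul_assoc] using hf (x⁻¹ * y), C, fun _ => hC _⟩

end HarmonicFunctions

theorem finite_dim_invariant_subspace_of_BHF_is_constants
    {G : Type*} [Group G] [Countable G]
    (μ : G → ℝ) (hnonneg : ∀ x, 0 ≤ μ x) (hprob : HasSum μ 1)
    (hsym : ∀ x : G, μ x⁻¹ = μ x)
    (hadapted : Subgroup.closure {x : G | μ x ≠ 0} = ⊤) :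
    (∀ V : Submodule ℂ (G → ℂ),
        (V : Set (G → ℂ)) ⊆ BHF μ →
        V ≠ ⊥ →
        (∀ (x : G), ∀ f ∈ V, (fun y : G => f (x⁻¹ * y)) ∈ V) →
        FiniteDimensional ℂ V →
        (V : Set (G → ℂ)) = {f | ∃ c : ℂ, f = fun _ => c})
    ∧
    ((∃ W : Submodule ℂ (G → ℂ), FiniteDimensional ℂ W ∧ BHF μ ⊆ (W : Set (G → ℂ))) →
      ∀ f ∈ BHF μ, ∃ c : ℂ, f = fun _ => c) := by
  refine ⟨fun V hV hne hinv hfin => ?_, ?_⟩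
  · have hconst {f : G → ℂ} (hf : f ∈ V) : ∃ c : ℂ, f = fun _ => c :=
      eq_const_of_mem_finiteDimensional hnonneg hprob hsym hadapted V hV hinv hf
    refine Set.Subset.antisymm (fun f hf => hconst hf) ?_
    rintro _ ⟨c, rfl⟩
    obtain ⟨f, hf, hf0⟩ := V.exists_mem_ne_zero_of_ne_bot hne
    obtain ⟨d, rfl⟩ := hconst hf
    have hd : d ≠ 0 := fun h => hf0 (by subst h; rfl)
    have hmem := V.smul_mem (c / d) hf
    have heq : (c / d) • (fun _ : G => d) = fun _ => c :=
      funext fun _ => div_mul_cancel₀ c hd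
    rwa [heq] at hmem
  · rintro ⟨W, hW, hsub⟩ f hf
    have : FiniteDimensional ℂ (boundedHarmonicSubmodule hnonneg hprob) :=
      Submodule.finiteDimensional_of_le (S₂ := W) hsub
    exact eq_const_of_mem_finiteDimensional hnonneg hprob hsym hadapted
      (boundedHarmonicSubmodule hnonneg hprob) subset_rfl (fun x g hg => BHF_translate hg x) hf
end
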